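/- arXiv:2108.08817 — 6 statements merged into one kernel-verified Lean document; each statement's English description precedes it below -/
import Mathlib

section
/- Let s be a positive integer and let M be an L-module of order s in ℂ[x,y]. Then there exist complex numbers a_{i,j} (i = 1,…,s; j = 1,2,…) such that, defining L : ℂ[x]^s → ℂ[x] by L(f_1,…,f_s) = ∑_{i=1}^{s} ∑_{j=1}^{∞} a_{i,j} · f_i^{(j)} (where f^{(j)} is the j-th derivative; the sum has only finitely many nonzero terms for any polynomials f_1,…,f_s), every F ∈ M satisfies [F]_n = L([F]_{n−s}, …, [F]_{n−1}) for every n ≥ s. -/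
open Polynomial
open scoped Pointwise BigOperators

noncomputable section

/-- `ℂ[x,y]` as `ℂ[x][y]`: outer variable is `y`, inner variable is `x`. -/
abbrev R2 : Type := Polynomial (Polynomial ℂ)

/-- The polynomial `(x,y) ↦ F(x+a, y+b)`. -/
noncomputable def polyTranslate (a b : ℂ) (F : R2) : R2 :=
  (F.map (aeval (X + C a) : Polynomial ℂ →ₐ[ℂ] Polynomial ℂ).toRingHom).comp (X + C (C b))

/-- A submodule of `ℂ[x,y]`: a translation invariant `ℂ`-linear subspace. -/
def IsSubmodule (M : Set R2) : Prop :=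
  (0 ∈ M) ∧ (∀ F ∈ M, ∀ G ∈ M, F + G ∈ M) ∧ (∀ (c : ℂ), ∀ F ∈ M, c • F ∈ M) ∧
    (∀ F ∈ M, ∀ a b : ℂ, polyTranslate a b F ∈ M)

/-- The `n`-th coordinate polynomial `[F]_n ∈ ℂ[x]`, so that `F = ∑ [F]_n · yⁿ/n!`. -/
noncomputable def coordPoly (F : R2) (n : ℕ) : Polynomial ℂ := (n.factorial : ℂ) • F.coeff n

/-- An L-module of order `s`. -/
def IsLModule (s : ℕ) (M : Set R2) : Prop :=
  IsSubmodule M ∧ ∀ F ∈ M, (∀ n < s, coordPoly F n = 0) → F = 0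

/-- `M_d = {F : deg_x F < d}`. -/
def Md (d : ℕ) : Set R2 := {F | ∀ n, (coordPoly F n).degree < (d : WithBot ℕ)}

/-- The map `L(f_1,…,f_s) = ∑_{i=1}^{s} ∑_{j=1}^{∞} a_{i,j} f_i^{(j)}`, where `a i j`
represents `a_{i+1, j+1}`. -/
noncomputable def Lmap {s : ℕ} (a : Fin s → ℕ → ℂ) (f : Fin s → Polynomial ℂ) :
    Polynomial ℂ :=
  ∑ i : Fin s, ∑ᶠ j : ℕ, a i (j + 1) • (Polynomial.derivative^[j + 1] (f i))

/-- `V_{A,s} = {([F]_0, …, [F]_{s−1}) : F ∈ A}`. -/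
def Vset (A : Set R2) (s : ℕ) : Set (Fin s → Polynomial ℂ) :=
  {φ | ∃ F ∈ A, ∀ i : Fin s, φ i = coordPoly F i}

/-- A submodule is decomposable if it is the sum of finitely many proper submodules. -/
def Decomposable (M : Set R2) : Prop :=
  ∃ (k : ℕ) (A : Fin k → Set R2), 0 < k ∧ (∀ i, IsSubmodule (A i) ∧ A i ⊂ M) ∧
    M = ∑ i : Fin k, A i

lemma Submodule.coeff_mem_of_forall_eval_mem {K A : Type*} [Field K] [Infinite K] [CommRing A]
    [Algebra K A] (N : Submodule K A) (G : A[X]) (h : ∀ a : K, G.eval (algebraMap K A a) ∈ N)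
    (k : ℕ) : G.coeff k ∈ N := by
  by_contra hk
  obtain ⟨f, hf, hN⟩ := Submodule.exists_le_ker_of_notMem hk
  let g : K[X] := ∑ i ∈ Finset.range (G.natDegree + 1), monomial i (f (G.coeff i))
  have hg : g = 0 := by
    apply Polynomial.funext
    intro a
    have := LinearMap.mem_ker.1 (hN (h a))
    rw [eval_eq_sum_range, map_sum] at this
    rw [eval_zero, ← this, eval_finsetSum]
    refine Finset.sum_congr rfl fun i _ => ?_
    rw [eval_monomial, ← map_pow, ← Algebra.commutes, ← Algebra.smul_def, map_smul, smul_eq_mul,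
      mul_comm]
  have hgk : g.coeff k = f (G.coeff k) := by
    simp only [g, finsetSum_coeff, coeff_monomial, Finset.sum_ite_eq', Finset.mem_range]
    split_ifs with h
    · rfl
    · rw [coeff_eq_zero_of_natDegree_lt (by omega), map_zero]
  exact hf (by rw [← hgk, hg, coeff_zero])

lemma Module.End.pow_apply_eq_zero_of_injective {K V : Type*} [Field K] [AddCommGroup V]
    [Module K V] {s : ℕ} (e : V →ₗ[K] Fin s → K) (he : ∀ v, e v = 0 → v = 0) (D : Module.End K V)
    {v : V} {m : ℕ} (hv : (D ^ m) v = 0) : (D ^ s) v = 0 := by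
  have he : Function.Injective e := LinearMap.ker_eq_bot.1 (LinearMap.ker_eq_bot'.2 he)
  have : Module.Finite K V := Module.Finite.of_injective e he
  have hs : Module.finrank K V ≤ s := by
    simpa using LinearMap.finrank_le_finrank_of_injective he
  have h : (D ^ Module.finrank K V) v = 0 :=
    Module.End.ker_pow_le_ker_pow_finrank D m (LinearMap.mem_ker.2 hv)
  rw [← Nat.sub_add_cancel hs, pow_add, Module.End.mul_apply, h, map_zero]

lemma LinearMap.exists_comp_eq_of_ker_le_ker {K V W : Type*} [Field K] [AddCommGroup V]
    [Module K V] [AddCommGroup W] [Module K W] (δ : V →ₗ[K] W) (ψ : V →ₗ[K] K)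
    (h : ∀ v, δ v = 0 → ψ v = 0) : ∃ φ : W →ₗ[K] K, ∀ v, φ (δ v) = ψ v := by
  have hψ : ψ ∈ LinearMap.range δ.dualMap := by
    rw [LinearMap.range_dualMap_eq_dualAnnihilator_ker, Submodule.mem_dualAnnihilator]
    exact h
  obtain ⟨φ, hφ⟩ := hψ
  exact ⟨φ, LinearMap.congr_fun hφ⟩

lemma polyTranslate_zero_left (b : ℂ) (F : R2) :
    polyTranslate 0 b F = (taylor X (F.map C)).eval (C (C b)) := by
  have h : ((aeval (X + C 0) : ℂ[X] →ₐ[ℂ] ℂ[X]).toRingHom) = RingHom.id _ := by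
    ext <;> simp
  rw [polyTranslate, h, Polynomial.map_id, taylor_eval, add_comm, eval_map, comp]

lemma exists_polyTranslate_zero_right (F : R2) :
    ∃ G : R2[X], (∀ a : ℂ, polyTranslate a 0 F = G.eval (C (C a))) ∧
      ∀ n, (G.coeff 1).coeff n = derivative (F.coeff n) := by
  induction F using Polynomial.induction_on' with
  | add F₁ F₂ h₁ h₂ =>
    obtain ⟨G₁, h₁, h₁'⟩ := h₁
    obtain ⟨G₂, h₂, h₂'⟩ := h₂
    refine ⟨G₁ + G₂, fun a => ?_, fun n => ?_⟩
    · rw [eval_add, ← h₁, ← h₂]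
      simp [polyTranslate]
    · simp [h₁', h₂']
  | monomial m p =>
    refine ⟨(taylor X (p.map C)).map C * C (X ^ m), fun a => ?_, fun n => ?_⟩
    · rw [eval_mul, eval_C, eval_map, eval₂_at_apply, taylor_eval, add_comm, eval_map]
      simp [polyTranslate, ← C_mul_X_pow_eq_monomial, aeval_def]
    · rw [coeff_mul_C, coeff_map, taylor_coeff_one, derivative_map, eval_map, eval₂_C_X,
        C_mul_X_pow_eq_monomial, coeff_monomial, coeff_monomial]
      split_ifs <;> simp

lemma coordPoly_derivative (F : R2) (n : ℕ) :
    coordPoly (derivative F) n = coordPoly F (n + 1) := by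
  rw [coordPoly, coordPoly, coeff_derivative, Nat.factorial_succ, Nat.cast_mul, mul_comm,
    mul_comm (n + 1 : ℂ[X]),
    mul_comm ((n + 1 : ℕ) : ℂ), mul_smul, smul_eq_C_mul ((n + 1 : ℕ) : ℂ)]
  simp [mul_comm]

lemma coordPoly_iterate_derivative (F : R2) (m n : ℕ) :
    coordPoly (derivative^[m] F) n = coordPoly F (m + n) := by
  induction m generalizing n with
  | zero => simp
  | succ m ih => rw [Function.iterate_succ_apply', coordPoly_derivative, ih]; congr 1; omega

/-- The coordinate polynomial as a linear map. -/
def coordPolyLinear (n : ℕ) : R2 →ₗ[ℂ] ℂ[X] where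
  toFun F := coordPoly F n
  map_add' F G := by simp [coordPoly]
  map_smul' c F := by simp [coordPoly, smul_comm c]

@[simp] lemma coordPolyLinear_apply (n : ℕ) (F : R2) :
    coordPolyLinear n F = coordPoly F n := rfl

lemma eq_zero_of_coordPoly_eq_zero {F : R2} (h : ∀ n, coordPoly F n = 0) : F = 0 := by
  ext1 n
  simpa [coordPoly, Nat.factorial_ne_zero] using h n

/-- A translation invariant subspace as a linear subspace. -/
def IsSubmodule.toSubmodule {M : Set R2} (hM : IsSubmodule M) : Submodule ℂ R2 where
  carrier := M
  add_mem' h₁ h₂ := hM.2.1 _ h₁ _ h₂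
  zero_mem' := hM.1
  smul_mem' c _ h := hM.2.2.1 c _ h

lemma IsSubmodule.derivative_mem {M : Set R2} (hM : IsSubmodule M) {F : R2} (hF : F ∈ M) :
    derivative F ∈ M := by
  have h := Submodule.coeff_mem_of_forall_eval_mem hM.toSubmodule (taylor X (F.map C))
    (fun b => by
      have := hM.2.2.2 F hF 0 b
      rwa [polyTranslate_zero_left] at this) 1
  rwa [taylor_coeff_one, derivative_map, eval_map, eval₂_C_X] at h

lemma IsSubmodule.iterate_derivative_mem {M : Set R2} (hM : IsSubmodule M) {F : R2} (hF : F ∈ M)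
    (m : ℕ) : derivative^[m] F ∈ M := by
  induction m with
  | zero => exact hF
  | succ m ih => rw [Function.iterate_succ_apply']; exact hM.derivative_mem ih

lemma IsSubmodule.exists_coordPoly_eq_derivative {M : Set R2} (hM : IsSubmodule M) {F : R2}
    (hF : F ∈ M) : ∃ G ∈ M, ∀ n, coordPoly G n = derivative (coordPoly F n) := by
  obtain ⟨G, hG, hG'⟩ := exists_polyTranslate_zero_right F
  refine ⟨G.coeff 1, Submodule.coeff_mem_of_forall_eval_mem hM.toSubmodule G (fun a => ?_) 1,
    fun n => by rw [coordPoly, hG', coordPoly, derivative_smul]⟩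
  have := hM.2.2.2 F hF a 0
  rwa [hG] at this

lemma IsSubmodule.exists_coordPoly_eq_iterate_derivative {M : Set R2} (hM : IsSubmodule M) {F : R2}
    (hF : F ∈ M) (k : ℕ) : ∃ G ∈ M, ∀ n, coordPoly G n = derivative^[k] (coordPoly F n) := by
  induction k with
  | zero => exact ⟨F, hF, fun n => rfl⟩
  | succ k ih =>
    obtain ⟨G, hG, h⟩ := ih
    obtain ⟨H, hH, h'⟩ := hM.exists_coordPoly_eq_derivative hG
    exact ⟨H, hH, fun n => by rw [h', h, Function.iterate_succ_apply']⟩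

/-- An element of an L-module of order `s` that does not depend on `x` has vanishing `s`-th
coordinate polynomial. -/
lemma IsLModule.coordPoly_eq_zero_of_derivative_eq_zero {s : ℕ} {M : Set R2} (hM : IsLModule s M)
    {F : R2} (hF : F ∈ M) (h : ∀ n < s, derivative (coordPoly F n) = 0) : coordPoly F s = 0 := by
  let K : Submodule ℂ R2 := hM.1.toSubmodule ⊓
    ⨅ n, LinearMap.ker (derivative ∘ₗ coordPolyLinear n)
  have mem_K {G : R2} : G ∈ K ↔ G ∈ M ∧ ∀ n, derivative (coordPoly G n) = 0 := by
    simp only [K, Submodule.mem_inf, Submodule.mem_iInf, LinearMap.mem_ker, LinearMap.comp_apply,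
      coordPolyLinear_apply]
    rfl
  have hFK : F ∈ K := by
    refine mem_K.2 ⟨hF, ?_⟩
    obtain ⟨G, hG, hGF⟩ := hM.1.exists_coordPoly_eq_derivative hF
    have := hM.2 G hG fun n hn => by rw [hGF, h n hn]
    intro n
    rw [← hGF, this]
    simp [coordPoly]
  let e : K →ₗ[ℂ] Fin s → ℂ :=
    LinearMap.pi (fun i => lcoeff ℂ 0 ∘ₗ coordPolyLinear i) ∘ₗ K.subtype
  have he (G : K) (h0 : e G = 0) : G = 0 := by
    obtain ⟨G, hG⟩ := G
    obtain ⟨hGM, hG⟩ := mem_K.1 hG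
    refine Subtype.ext (hM.2 G hGM fun n hn => ?_)
    have h1 : (coordPoly G n).coeff 0 = 0 := congrFun h0 ⟨n, hn⟩
    rw [eq_C_of_derivative_eq_zero (hG n), h1, C_0]
  let D : Module.End ℂ K := (derivative.restrictScalars ℂ).restrict (p := K) (q := K) fun G hG =>
    mem_K.2 ⟨hM.1.derivative_mem (mem_K.1 hG).1, fun n => by
      rw [LinearMap.restrictScalars_apply, coordPoly_derivative]; exact (mem_K.1 hG).2 _⟩
  have hD (m : ℕ) (G : K) : ((D ^ m) G : R2) = derivative^[m] (G : R2) := by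
    induction m with
    | zero => rfl
    | succ m ih => rw [pow_succ', Function.iterate_succ_apply', ← ih]; rfl
  have h1 : (D ^ (F.natDegree + 1)) ⟨F, hFK⟩ = 0 :=
    Subtype.ext ((hD _ _).trans (iterate_derivative_eq_zero (Nat.lt_succ_self _)))
  have h2 : (D ^ s) ⟨F, hFK⟩ = 0 := Module.End.pow_apply_eq_zero_of_injective (V := K) e he D h1
  have h3 : derivative^[s] F = 0 := (hD s ⟨F, hFK⟩).symm.trans (congrArg Subtype.val h2)
  have h4 := coordPoly_iterate_derivative F s 0
  rw [h3] at h4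
  rw [← add_zero s, ← h4]
  simp [coordPoly]

lemma support_smul_iterate_derivative_subset (c : ℕ → ℂ) (p : ℂ[X]) :
    (Function.support fun j => c j • derivative^[j] p) ⊆ Finset.range (p.natDegree + 1) := by
  intro j hj
  by_contra h
  apply hj
  simp only [Finset.coe_range, Set.mem_Iio, not_lt] at h
  simp only
  rw [iterate_derivative_eq_zero (by omega), smul_zero]

lemma eval_zero_iterate_derivative (p : ℂ[X]) (j : ℕ) :
    (derivative^[j] p).eval 0 = j.factorial * p.coeff j := by
  rw [← coeff_zero_eq_eval_zero, coeff_iterate_derivative]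
  simp [Nat.descFactorial_self]

lemma eval_zero_finsum_smul_iterate_derivative (ψ : ℂ[X] →ₗ[ℂ] ℂ) (p : ℂ[X]) :
    (∑ᶠ j : ℕ, ψ (monomial j (j.factorial : ℂ)⁻¹) • derivative^[j] p).eval 0 = ψ p := by
  rw [finsum_eq_sum_of_support_subset _ (support_smul_iterate_derivative_subset _ p),
    eval_finsetSum]
  conv_rhs => rw [p.as_sum_range, map_sum]
  refine Finset.sum_congr rfl fun j _ => ?_
  rw [eval_smul, eval_zero_iterate_derivative, smul_eq_mul, mul_comm, ← smul_eq_mul, ← map_smul,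
    smul_monomial, smul_eq_mul, mul_right_comm, mul_inv_cancel₀ (by exact_mod_cast
      j.factorial_ne_zero), one_mul]

lemma iterate_derivative_Lmap {s : ℕ} (a : Fin s → ℕ → ℂ) (f : Fin s → ℂ[X]) (k : ℕ) :
    derivative^[k] (Lmap a f) = Lmap a fun i => derivative^[k] (f i) := by
  rw [Lmap, Lmap, ← Module.End.pow_apply, map_sum]
  refine Finset.sum_congr rfl fun i _ => ?_
  simp_rw [Function.iterate_succ_apply]
  erw [(derivative ^ k : Module.End ℂ ℂ[X]).toAddMonoidHom.map_finsum
    ((Finset.finite_toSet _).subset (support_smul_iterate_derivative_subset _ _))]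
  refine finsum_congr fun j => ?_
  simp only [LinearMap.toAddMonoidHom_coe, map_smul, Module.End.pow_apply,
    ← Function.iterate_succ_apply, ← Function.iterate_add_apply]
  congr 2
  omega

lemma eq_of_eval_zero_iterate_derivative_eq {p q : ℂ[X]}
    (h : ∀ k, (derivative^[k] p).eval 0 = (derivative^[k] q).eval 0) : p = q := by
  ext k
  simpa [eval_zero_iterate_derivative, Nat.factorial_ne_zero] using h k

/-- Every L-module of order `s` admits a representing linear map of the form
`L(f_1,…,f_s) = ∑_{i=1}^{s} ∑_{j=1}^{∞} a_{i,j} f_i^{(j)}` with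
`[F]_n = L([F]_{n−s},…,[F]_{n−1})` for all `F ∈ M` and `n ≥ s`. -/
theorem stmt0 (s : ℕ) (hs : 0 < s) (M : Set R2) (hM : IsLModule s M) :
    ∃ a : Fin s → ℕ → ℂ, ∀ F ∈ M, ∀ n : ℕ, s ≤ n →
      coordPoly F n = Lmap a (fun i : Fin s => coordPoly F (n - s + i)) := by
  let N := hM.1.toSubmodule
  let δ : N →ₗ[ℂ] Fin s → ℂ[X] :=
    LinearMap.pi (fun i => derivative ∘ₗ coordPolyLinear i) ∘ₗ N.subtype
  let ψ : N →ₗ[ℂ] ℂ := leval 0 ∘ₗ coordPolyLinear s ∘ₗ N.subtype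
  have hker (v : N) (hv : δ v = 0) : ψ v = 0 := by
    obtain ⟨F, hF⟩ := v
    have h0 := hM.coordPoly_eq_zero_of_derivative_eq_zero hF fun n hn => congrFun hv ⟨n, hn⟩
    change (coordPoly F s).eval 0 = 0
    rw [h0, eval_zero]
  obtain ⟨φ, hφ⟩ := LinearMap.exists_comp_eq_of_ker_le_ker (V := N) δ ψ hker
  have hφ' (F : R2) (hF : F ∈ M) :
      φ (fun i => derivative (coordPoly F i)) = (coordPoly F s).eval 0 := hφ ⟨F, hF⟩
  let a : Fin s → ℕ → ℂ := fun i j =>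
    φ (Pi.single i (monomial (j - 1) ((j - 1).factorial : ℂ)⁻¹))
  have ha (f : Fin s → ℂ[X]) : (Lmap a f).eval 0 = φ fun i => derivative (f i) := by
    rw [Lmap, eval_finsetSum, ← Finset.univ_sum_single fun i => derivative (f i), map_sum]
    exact Finset.sum_congr rfl fun i _ => eval_zero_finsum_smul_iterate_derivative
      (φ ∘ₗ LinearMap.single ℂ (fun _ => ℂ[X]) i) (derivative (f i))
  refine ⟨a, fun F hF n hn => ?_⟩
  obtain ⟨m, rfl⟩ := Nat.exists_eq_add_of_le' hn
  rw [Nat.add_sub_cancel]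
  simp_rw [← coordPoly_iterate_derivative F m]
  refine eq_of_eval_zero_iterate_derivative_eq fun k => ?_
  obtain ⟨G, hG, hGF⟩ :=
    hM.1.exists_coordPoly_eq_iterate_derivative (hM.1.iterate_derivative_mem hF m) k
  rw [iterate_derivative_Lmap, ha]
  simp_rw [← hGF]
  exact (hφ' G hG).symm
end
end

section
/- If M is an L-module of order s in ℂ[x,y] and d ≥ 0 is an integer, then the polynomial x^d·y^s does not belong to M_d + M. Consequently, M_d + M is a proper submodule of ℂ[x,y]. -/
open Polynomial
open scoped Pointwise BigOperators

noncomputable section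

theorem coordPoly_eq_zero_iff {F : R2} {n : ℕ} : coordPoly F n = 0 ↔ F.coeff n = 0 := by
  simp [coordPoly, Nat.factorial_ne_zero]

theorem mem_Md_iff {d : ℕ} {F : R2} : F ∈ Md d ↔ ∀ n, F.coeff n ∈ degreeLT ℂ d := by
  refine forall_congr' fun n => ?_
  rw [← mem_degreeLT, coordPoly]
  exact (degreeLT ℂ d).smul_mem_iff (Nat.cast_ne_zero.2 n.factorial_ne_zero)

theorem polyTranslate_eq_taylor (a b : ℂ) (F : R2) :
    polyTranslate a b F =
      taylor (C b) (F.map (aeval (X + C a) : ℂ[X] →ₐ[ℂ] ℂ[X]).toRingHom) := by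
  rw [taylor_apply, polyTranslate]

theorem polyTranslate_add (a b : ℂ) (F G : R2) :
    polyTranslate a b (F + G) = polyTranslate a b F + polyTranslate a b G := by
  simp [polyTranslate_eq_taylor]

theorem polyTranslate_coeff_zero_right (a : ℂ) (F : R2) (n : ℕ) :
    (polyTranslate a 0 F).coeff n = taylor a (F.coeff n) := by
  simp [polyTranslate, taylor_apply, aeval_def, comp, coeff_map]

theorem polyTranslate_mem_Md {d : ℕ} {F : R2} (hF : F ∈ Md d) (a b : ℂ) :
    polyTranslate a b F ∈ Md d := by
  rw [mem_Md_iff] at hF ⊢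
  intro n
  rw [polyTranslate_eq_taylor, taylor_coeff, eval_eq_sum_range]
  refine Submodule.sum_mem _ fun i _ => ?_
  have key : taylor a (F.coeff (i + n)) ∈ degreeLT ℂ d := by
    rw [mem_degreeLT, degree_taylor]
    exact mem_degreeLT.1 (hF _)
  have h := (degreeLT ℂ d).smul_mem (((i + n).choose n : ℂ) * b ^ i) key
  convert h using 1
  rw [hasseDeriv_coeff, coeff_map, smul_eq_C_mul, taylor_apply]
  simp [aeval_def, comp]
  ring

theorem isSubmodule_Md (d : ℕ) : IsSubmodule (Md d) := by
  refine ⟨?_, fun F hF G hG => ?_, fun c F hF => ?_, fun F hF => polyTranslate_mem_Md hF⟩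
  · simp [mem_Md_iff]
  · rw [mem_Md_iff] at *
    exact fun n => by simpa using add_mem (hF n) (hG n)
  · rw [mem_Md_iff] at *
    exact fun n => by simpa using (degreeLT ℂ d).smul_mem c (hF n)

theorem IsSubmodule.add {A B : Set R2} (hA : IsSubmodule A) (hB : IsSubmodule B) :
    IsSubmodule (A + B) := by
  obtain ⟨hA0, hA1, hA2, hA3⟩ := hA
  obtain ⟨hB0, hB1, hB2, hB3⟩ := hB
  refine ⟨⟨0, hA0, 0, hB0, add_zero 0⟩, ?_, ?_, ?_⟩
  · rintro _ ⟨F, hF, G, hG, rfl⟩ _ ⟨F', hF', G', hG', rfl⟩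
    exact ⟨_, hA1 F hF F' hF', _, hB1 G hG G' hG', add_add_add_comm F F' G G'⟩
  · rintro c _ ⟨F, hF, G, hG, rfl⟩
    exact ⟨_, hA2 c F hF, _, hB2 c G hG, (smul_add c F G).symm⟩
  · rintro _ ⟨F, hF, G, hG, rfl⟩ a b
    exact ⟨_, hA3 F hF a b, _, hB3 G hG a b, (polyTranslate_add a b F G).symm⟩

theorem coeff_taylor_one_sub_self {f : ℂ[X]} {d : ℕ} (hf : f.natDegree ≤ d + 1) :
    (taylor 1 f - f).coeff d = (d + 1) * f.coeff (d + 1) := by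
  have h : (hasseDeriv d f).natDegree < 2 := by
    have := natDegree_hasseDeriv_le f d
    omega
  rw [coeff_sub, taylor_coeff, eval_eq_sum_range' h]
  simp [Finset.sum_range_succ, hasseDeriv_coeff, add_comm 1 d]

theorem natDegree_taylor_one_sub_self_le {f : ℂ[X]} {d : ℕ} (hf : f.natDegree ≤ d + 1) :
    (taylor 1 f - f).natDegree ≤ d := by
  rw [natDegree_le_iff_coeff_eq_zero]
  intro N hN
  have h : (hasseDeriv N f).natDegree < 1 := by
    have := natDegree_hasseDeriv_le f N
    omega
  rw [coeff_sub, taylor_coeff, eval_eq_sum_range' h]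
  simp [hasseDeriv_coeff]

/-- In an L-module of order `s`, the leading part in `x` of an element is determined by its
first `s` coordinates. -/
theorem IsLModule.coeff_coeff_eq_zero {s : ℕ} {M : Set R2} (hM : IsLModule s M) (d : ℕ) :
    ∀ F ∈ M, (∀ n, (F.coeff n).natDegree ≤ d) → (∀ n < s, (F.coeff n).coeff d = 0) →
      ∀ n, (F.coeff n).coeff d = 0 := by
  induction d with
  | zero =>
    intro F hF hdeg h0 n
    have hF0 : F = 0 := hM.2 F hF fun n hn => by
      rw [coordPoly_eq_zero_iff, eq_C_of_natDegree_le_zero (hdeg n), h0 n hn, C_0]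
    simp [hF0]
  | succ d ih =>
    intro F hF hdeg h0 n
    obtain ⟨-, hadd, hsmul, htr⟩ := hM.1
    have hΔ : ∀ n, (polyTranslate 1 0 F + (-1 : ℂ) • F).coeff n =
        taylor 1 (F.coeff n) - F.coeff n := fun n => by
      rw [coeff_add, polyTranslate_coeff_zero_right, coeff_smul, neg_one_smul, sub_eq_add_neg]
    have key := ih _ (hadd _ (htr F hF 1 0) _ (hsmul (-1) F hF))
      (fun n => by rw [hΔ]; exact natDegree_taylor_one_sub_self_le (hdeg n))
      (fun n hn => by rw [hΔ, coeff_taylor_one_sub_self (hdeg n), h0 n hn, mul_zero]) n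
    rw [hΔ, coeff_taylor_one_sub_self (hdeg n)] at key
    exact (mul_eq_zero.1 key).resolve_left (Nat.cast_add_one_ne_zero d)

/-- If `M` is an L-module of order `s` and `d ≥ 0`, then `x^d y^s ∉ M_d + M`;
consequently `M_d + M` is a proper submodule of `ℂ[x,y]`. -/
theorem stmt2 (s : ℕ) (hs : 0 < s) (M : Set R2) (hM : IsLModule s M) (d : ℕ) :
    (C (X ^ d) * X ^ s : R2) ∉ Md d + M ∧
      IsSubmodule (Md d + M) ∧ Md d + M ≠ Set.univ := by
  have hnot : (C (X ^ d) * X ^ s : R2) ∉ Md d + M := by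
    rintro ⟨G, hG, F, hF, hGF : G + F = C (X ^ d) * X ^ s⟩
    rw [mem_Md_iff] at hG
    have hcoeff : ∀ n, F.coeff n = (if n = s then X ^ d else 0) - G.coeff n := fun n => by
      rw [eq_sub_iff_add_eq', ← coeff_add, hGF, coeff_C_mul_X_pow]
    have hGd : ∀ n, (G.coeff n).coeff d = 0 := fun n =>
      coeff_eq_zero_of_degree_lt (mem_degreeLT.1 (hG n))
    have h := hM.coeff_coeff_eq_zero d F hF
      (fun n => by
        rw [hcoeff]
        refine (natDegree_sub_le_of_le (m := d) ?_
          (natDegree_le_of_degree_le (mem_degreeLT.1 (hG n)).le)).trans_eq (max_self d)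
        split_ifs <;> simp)
      (fun n hn => by rw [hcoeff, coeff_sub, hGd, if_neg hn.ne, coeff_zero, sub_zero]) s
    simp [hcoeff, hGd] at h
  exact ⟨hnot, (isSubmodule_Md d).add hM.1, fun h => hnot (h ▸ Set.mem_univ _)⟩
end
end

section
/- Let A be a proper submodule of ℂ[x,y] (i.e. A ≠ ℂ[x,y]). Then there exist integers d ≥ 0 and s ≥ 1 and an L-module M of order s such that A = M_d + M. -/
open Polynomial
open scoped Pointwise BigOperators

noncomputable section

/-- Partial derivative in `y`. -/
def dy : R2 →ₗ[ℂ] R2 := (derivative : R2 →ₗ[ℂ[X]] R2).restrictScalars ℂ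

/-- Partial derivative in `x`. -/
def dx : R2 →ₗ[ℂ] R2 :=
  lsum fun n => ((monomial n : ℂ[X] →ₗ[ℂ[X]] R2).restrictScalars ℂ).comp derivative

lemma coeff_dx (F : R2) (n : ℕ) : (dx F).coeff n = derivative (F.coeff n) := by
  change (F.sum fun n f => monomial n (derivative f)).coeff n = _
  rw [Polynomial.sum_def, finsetSum_coeff]
  simp only [coeff_monomial]
  rw [Finset.sum_ite_eq']
  split_ifs with h
  · rfl
  · rw [notMem_support_iff.1 h, derivative_zero]

lemma coeff_dx_pow (F : R2) (k n : ℕ) : ((dx ^ k) F).coeff n = derivative^[k] (F.coeff n) := by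
  induction k with
  | zero => rfl
  | succ k ih => rw [pow_succ', Module.End.mul_apply, coeff_dx, ih, Function.iterate_succ_apply']

lemma dy_pow_apply (F : R2) (k : ℕ) : (dy ^ k) F = derivative^[k] F := by
  induction k with
  | zero => rfl
  | succ k ih => rw [pow_succ', Module.End.mul_apply, ih, Function.iterate_succ_apply']; rfl

lemma dx_comm_dy : Commute dx dy := by
  refine LinearMap.ext fun F => Polynomial.ext fun n => ?_
  rw [Module.End.mul_apply, Module.End.mul_apply, coeff_dx]
  change derivative ((derivative F).coeff n) = (derivative (dx F)).coeff n
  rw [coeff_derivative, coeff_derivative, coeff_dx, ← Nat.cast_succ, derivative_mul]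
  simp

/-- The coefficient of `F` on `xⁱyʲ/(i!j!)`. -/
def dividedCoeff (i j : ℕ) : R2 →ₗ[ℂ] ℂ :=
  ((i.factorial * j.factorial : ℕ) : ℂ) •
    (lcoeff ℂ i).comp ((lcoeff ℂ[X] j).restrictScalars ℂ)

lemma dividedCoeff_apply (i j : ℕ) (F : R2) :
    dividedCoeff i j F = ((i.factorial * j.factorial : ℕ) : ℂ) * (F.coeff j).coeff i := rfl

lemma dividedCoeff_dx (i j : ℕ) (F : R2) :
    dividedCoeff i j (dx F) = dividedCoeff (i + 1) j F := by
  rw [dividedCoeff_apply, dividedCoeff_apply, coeff_dx, coeff_derivative, Nat.factorial_succ]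
  push_cast
  ring

lemma dividedCoeff_dy (i j : ℕ) (F : R2) :
    dividedCoeff i j (dy F) = dividedCoeff i (j + 1) F := by
  change dividedCoeff i j (derivative F) = _
  rw [dividedCoeff_apply, dividedCoeff_apply, coeff_derivative, ← Nat.cast_succ,
    coeff_mul_natCast, Nat.factorial_succ]
  push_cast
  ring

lemma dividedCoeff_dx_pow (k i j : ℕ) (F : R2) :
    dividedCoeff i j ((dx ^ k) F) = dividedCoeff (i + k) j F := by
  induction k generalizing i with
  | zero => rfl
  | succ k ih =>
    rw [pow_succ', Module.End.mul_apply, dividedCoeff_dx, ih]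
    congr 2
    ring

lemma dividedCoeff_dy_pow (k i j : ℕ) (F : R2) :
    dividedCoeff i j ((dy ^ k) F) = dividedCoeff i (j + k) F := by
  induction k generalizing j with
  | zero => rfl
  | succ k ih =>
    rw [pow_succ', Module.End.mul_apply, dividedCoeff_dy, ih]
    congr 2
    ring

lemma ext_dividedCoeff {F G : R2} (h : ∀ i j, dividedCoeff i j F = dividedCoeff i j G) :
    F = G := by
  refine Polynomial.ext fun j => Polynomial.ext fun i => ?_
  have := h i j
  rw [dividedCoeff_apply, dividedCoeff_apply] at this
  exact mul_left_cancel₀ (Nat.cast_ne_zero.2 (by positivity)) this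

lemma exists_dy_pow_eq_zero (F : R2) : ∃ N, (dy ^ N) F = 0 :=
  ⟨F.natDegree + 1, by rw [dy_pow_apply, iterate_derivative_eq_zero (Nat.lt_succ_self _)]⟩

lemma exists_dx_pow_eq_zero (F : R2) : ∃ N, (dx ^ N) F = 0 := by
  refine ⟨F.support.sup (fun n => (F.coeff n).natDegree) + 1, Polynomial.ext fun n => ?_⟩
  rw [coeff_dx_pow, coeff_zero]
  by_cases h : n ∈ F.support
  · exact iterate_derivative_eq_zero
      (Nat.lt_succ_of_le (Finset.le_sup (f := fun n => (F.coeff n).natDegree) h))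
  · rw [notMem_support_iff.1 h, iterate_derivative_zero]

lemma pow_apply_eq_zero_of_le {D : R2 →ₗ[ℂ] R2} {F : R2} {m n : ℕ} (hmn : m ≤ n)
    (h : (D ^ m) F = 0) : (D ^ n) F = 0 := by
  rw [← Nat.sub_add_cancel hmn, pow_add, Module.End.mul_apply, h, map_zero]

/-- Every array of finite support is the array of divided coefficients of a polynomial. -/
lemma exists_dividedCoeff_eq (c : ℕ → ℕ → ℂ) (M N : ℕ) (hM : ∀ i j, M ≤ i → c i j = 0)
    (hN : ∀ i j, N ≤ j → c i j = 0) : ∃ H : R2, ∀ i j, dividedCoeff i j H = c i j := by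
  refine ⟨∑ j ∈ Finset.range N, monomial j (∑ i ∈ Finset.range M,
    monomial i (c i j / ((i.factorial * j.factorial : ℕ) : ℂ))), fun i j => ?_⟩
  have hne : ((i.factorial * j.factorial : ℕ) : ℂ) ≠ 0 := Nat.cast_ne_zero.2 (by positivity)
  rw [dividedCoeff_apply]
  simp only [finsetSum_coeff, coeff_monomial, Finset.sum_ite_eq', Finset.mem_range]
  split_ifs with h
  · simp only [finsetSum_coeff, coeff_monomial, Finset.sum_ite_eq', Finset.mem_range]
    split_ifs with h'
    · field_simp
    · rw [hM i j (not_lt.1 h'), mul_zero]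
  · rw [hN i j (not_lt.1 h), coeff_zero, mul_zero]

lemma commute_apply {f D : R2 →ₗ[ℂ] R2} (h : Commute f D) (F : R2) : f (D F) = D (f F) :=
  LinearMap.congr_fun h F

lemma dx_surjective : Function.Surjective dx := by
  intro F
  obtain ⟨M, hM⟩ := exists_dx_pow_eq_zero F
  obtain ⟨N, hN⟩ := exists_dy_pow_eq_zero F
  obtain ⟨H, hH⟩ := exists_dividedCoeff_eq
    (fun i j => if i = 0 then 0 else dividedCoeff (i - 1) j F) (M + 1) N
    (fun i j h => by
      rw [if_neg (by lia), show i - 1 = (i - 1 - M) + M by lia, ← dividedCoeff_dx_pow, hM,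
        map_zero])
    (fun i j h => by
      split_ifs
      · rfl
      · rw [show j = (j - N) + N by lia, ← dividedCoeff_dy_pow, hN, map_zero])
  exact ⟨H, ext_dividedCoeff fun i j => by rw [dividedCoeff_dx, hH]; simp⟩

lemma dx_pow_surjective (e : ℕ) : Function.Surjective (dx ^ e) := by
  rw [Module.End.coe_pow]
  exact dx_surjective.iterate e

lemma dy_surjective_on_ker_dx {F : R2} (hF : dx F = 0) : ∃ G, dx G = 0 ∧ dy G = F := by
  obtain ⟨N, hN⟩ := exists_dy_pow_eq_zero F
  have h1 (i j : ℕ) : dividedCoeff (i + 1) j F = 0 := by rw [← dividedCoeff_dx, hF, map_zero]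
  obtain ⟨H, hH⟩ := exists_dividedCoeff_eq
    (fun i j => if j = 0 then 0 else dividedCoeff i (j - 1) F) 1 (N + 1)
    (fun i j h => by
      split_ifs
      · rfl
      · rw [show i = i - 1 + 1 by lia, h1])
    (fun i j h => by
      rw [if_neg (by lia), show j - 1 = (j - 1 - N) + N by lia, ← dividedCoeff_dy_pow, hN,
        map_zero])
  refine ⟨H, ext_dividedCoeff fun i j => ?_, ext_dividedCoeff fun i j => ?_⟩
  · rw [dividedCoeff_dx, hH, map_zero, h1]
    simp
  · rw [dividedCoeff_dy, hH]
    simp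

lemma dy_pow_surjective_on_ker_dx (n : ℕ) {F : R2} (hF : dx F = 0) :
    ∃ G, dx G = 0 ∧ (dy ^ n) G = F := by
  induction n with
  | zero => exact ⟨F, hF, rfl⟩
  | succ n ih =>
    obtain ⟨G, hG, rfl⟩ := ih
    obtain ⟨H, hH, rfl⟩ := dy_surjective_on_ker_dx hG
    exact ⟨H, hH, by rw [pow_succ, Module.End.mul_apply]⟩

/-- Every linear functional is the constant term of an operator commuting with `dx` and `dy`. -/
lemma exists_operator_of_functional (φ : R2 →ₗ[ℂ] ℂ) :
    ∃ h : R2 →ₗ[ℂ] R2, ∀ G i j, dividedCoeff i j (h G) = φ ((dx ^ i) ((dy ^ j) G)) := by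
  have key (G : R2) : ∃ H, ∀ i j, dividedCoeff i j H = φ ((dx ^ i) ((dy ^ j) G)) := by
    obtain ⟨M, hM⟩ := exists_dx_pow_eq_zero G
    obtain ⟨N, hN⟩ := exists_dy_pow_eq_zero G
    refine exists_dividedCoeff_eq _ M N (fun i j h => ?_) (fun i j h => ?_)
    · rw [← Module.End.mul_apply, (dx_comm_dy.pow_pow i j).eq, Module.End.mul_apply,
        pow_apply_eq_zero_of_le h hM, map_zero, map_zero]
    · rw [pow_apply_eq_zero_of_le h hN, map_zero, map_zero]
  choose h hh using key
  exact ⟨{ toFun := h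
           map_add' := fun F G => ext_dividedCoeff fun i j => by simp only [map_add, hh]
           map_smul' := fun c F => ext_dividedCoeff fun i j => by
             simp only [map_smul, hh, RingHom.id_apply] }, hh⟩

lemma commute_of_dividedCoeff_eq {φ : R2 →ₗ[ℂ] ℂ} {h : R2 →ₗ[ℂ] R2}
    (hh : ∀ G i j, dividedCoeff i j (h G) = φ ((dx ^ i) ((dy ^ j) G))) :
    Commute h dx ∧ Commute h dy := by
  refine ⟨LinearMap.ext fun F => ext_dividedCoeff fun i j => ?_,
    LinearMap.ext fun F => ext_dividedCoeff fun i j => ?_⟩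
  · rw [Module.End.mul_apply, Module.End.mul_apply, dividedCoeff_dx, hh, hh,
      ← Module.End.mul_apply (dy ^ j), ← (dx_comm_dy.pow_right j).eq, Module.End.mul_apply,
      ← Module.End.mul_apply (dx ^ i), ← pow_succ]
  · rw [Module.End.mul_apply, Module.End.mul_apply, dividedCoeff_dy, hh, hh,
      ← Module.End.mul_apply (dy ^ j), ← pow_succ]

/-- Taylor expansion with divided derivatives. -/
lemma taylor_eq_sum_iterate_derivative {R : Type*} [CommRing R] [Algebra ℂ R] (r : R) (f : R[X])
    {N : ℕ} (hN : f.natDegree < N) :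
    taylor r f = ∑ i ∈ Finset.range N,
      C (r ^ i) * ((i.factorial : ℂ)⁻¹ • derivative^[i] f) := by
  have hd (i : ℕ) : (i.factorial : ℂ)⁻¹ • derivative^[i] f = hasseDeriv i f := by
    rw [← factorial_smul_hasseDeriv, LinearMap.smul_apply, ← Nat.cast_smul_eq_nsmul ℂ,
      smul_smul, inv_mul_cancel₀ (Nat.cast_ne_zero.2 i.factorial_ne_zero), one_smul]
  ext n
  have hn : (hasseDeriv n f).natDegree < N := (natDegree_hasseDeriv_le f n).trans_lt (by lia)
  rw [taylor_coeff, eval_eq_sum_range' hn, finsetSum_coeff]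
  refine Finset.sum_congr rfl fun i _ => ?_
  rw [hd, coeff_C_mul, hasseDeriv_coeff, hasseDeriv_coeff, add_comm n i, Nat.choose_symm_add]
  ring

lemma polyTranslate_zero_left_s4 (b : ℂ) (F : R2) {N : ℕ} (hN : F.natDegree < N) :
    polyTranslate 0 b F = ∑ i ∈ Finset.range N, b ^ i • ((i.factorial : ℂ)⁻¹ • (dy ^ i) F) := by
  have h : (aeval (X + C (0 : ℂ)) : ℂ[X] →ₐ[ℂ] ℂ[X]).toRingHom = RingHom.id _ := by
    ext <;> simp
  rw [polyTranslate, h, Polynomial.map_id, ← taylor_apply,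
    taylor_eq_sum_iterate_derivative _ _ hN]
  refine Finset.sum_congr rfl fun i _ => ?_
  rw [dy_pow_apply, ← C_pow, ← smul_eq_C_mul]
  exact algebraMap_smul ℂ[X] (b ^ i) _

lemma polyTranslate_zero_right (a : ℂ) (F : R2) {N : ℕ} (hN : ∀ n, (F.coeff n).natDegree < N) :
    polyTranslate a 0 F = ∑ i ∈ Finset.range N, a ^ i • ((i.factorial : ℂ)⁻¹ • (dx ^ i) F) := by
  ext1 n
  rw [polyTranslate, C_0, C_0, add_zero, comp_X, coeff_map, finsetSum_coeff]
  refine (taylor_apply a (F.coeff n)).symm.trans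
    ((taylor_eq_sum_iterate_derivative a (F.coeff n) (hN n)).trans
      (Finset.sum_congr rfl fun i _ => ?_))
  rw [coeff_smul, coeff_smul, coeff_dx_pow, smul_eq_C_mul (a ^ i)]

lemma polyTranslate_eq (a b : ℂ) (F : R2) :
    polyTranslate a b F = polyTranslate 0 b (polyTranslate a 0 F) := by
  have h : (aeval (X + C (0 : ℂ)) : ℂ[X] →ₐ[ℂ] ℂ[X]).toRingHom = RingHom.id _ := by
    ext <;> simp
  rw [polyTranslate, polyTranslate, polyTranslate, h, Polynomial.map_id, C_0, C_0, add_zero,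
    comp_X]

lemma exists_natDegree_coeff_lt (F : R2) : ∃ N, ∀ n, (F.coeff n).natDegree < N := by
  refine ⟨F.support.sup (fun n => (F.coeff n).natDegree) + 1, fun n => ?_⟩
  by_cases h : n ∈ F.support
  · exact Nat.lt_succ_of_le (Finset.le_sup (f := fun n => (F.coeff n).natDegree) h)
  · rw [notMem_support_iff.1 h]
    simp

lemma pow_apply_mem {N : Submodule ℂ R2} {D : R2 →ₗ[ℂ] R2} (hD : ∀ F ∈ N, D F ∈ N) {F : R2}
    (hF : F ∈ N) (k : ℕ) : (D ^ k) F ∈ N := by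
  induction k with
  | zero => exact hF
  | succ k ih => rw [pow_succ', Module.End.mul_apply]; exact hD _ ih

lemma polyTranslate_mem {N : Submodule ℂ R2} (hx : ∀ F ∈ N, dx F ∈ N) (hy : ∀ F ∈ N, dy F ∈ N)
    {F : R2} (hF : F ∈ N) (a b : ℂ) : polyTranslate a b F ∈ N := by
  have h : polyTranslate a 0 F ∈ N := by
    obtain ⟨M, hM⟩ := exists_natDegree_coeff_lt F
    rw [polyTranslate_zero_right a F hM]
    exact sum_mem fun i _ => N.smul_mem _ (N.smul_mem _ (pow_apply_mem hx hF i))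
  rw [polyTranslate_eq, polyTranslate_zero_left_s4 b _ (Nat.lt_succ_self _)]
  exact sum_mem fun i _ => N.smul_mem _ (N.smul_mem _ (pow_apply_mem hy h i))

/-- A subspace containing all values of a polynomial curve contains its coefficients. -/
lemma coeff_mem_of_sum_mem {V : Type*} [AddCommGroup V] [Module ℂ V] (N : Submodule ℂ V)
    (v : ℕ → V) (n : ℕ) (h : ∀ a : ℂ, ∑ i ∈ Finset.range n, a ^ i • v i ∈ N) {k : ℕ}
    (hk : k < n) : v k ∈ N := by
  by_contra hv
  obtain ⟨φ, hφ, hN⟩ := N.exists_le_ker_of_notMem hv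
  have h0 : (∑ i ∈ Finset.range n, monomial i (φ (v i)) : ℂ[X]) = 0 := by
    refine Polynomial.funext fun a => ?_
    have := hN (h a)
    rw [LinearMap.mem_ker, map_sum] at this
    rw [eval_finsetSum, eval_zero, ← this]
    exact Finset.sum_congr rfl fun i _ => by rw [eval_monomial, map_smul, smul_eq_mul, mul_comm]
  apply hφ
  have := congrArg (fun p => coeff p k) h0
  simpa [coeff_monomial, hk] using this

lemma dx_mem_of_polyTranslate_mem {N : Submodule ℂ R2}
    (hN : ∀ F ∈ N, ∀ a b, polyTranslate a b F ∈ N) {F : R2} (hF : F ∈ N) : dx F ∈ N := by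
  obtain ⟨M, hM⟩ := exists_natDegree_coeff_lt F
  have := coeff_mem_of_sum_mem N (fun i => (i.factorial : ℂ)⁻¹ • (dx ^ i) F) (M + 2)
    (fun a => by
      rw [← polyTranslate_zero_right a F fun n => (hM n).trans (by lia)]
      exact hN F hF a 0) (k := 1) (by lia)
  simpa using this

lemma dy_mem_of_polyTranslate_mem {N : Submodule ℂ R2}
    (hN : ∀ F ∈ N, ∀ a b, polyTranslate a b F ∈ N) {F : R2} (hF : F ∈ N) : dy F ∈ N := by
  have := coeff_mem_of_sum_mem N (fun i => (i.factorial : ℂ)⁻¹ • (dy ^ i) F) (F.natDegree + 2)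
    (fun b => by
      rw [← polyTranslate_zero_left_s4 b F (by lia)]
      exact hN F hF 0 b) (k := 1) (by lia)
  simpa using this

lemma mem_Md_iff_s4 (d : ℕ) (F : R2) : F ∈ Md d ↔ (dx ^ d) F = 0 := by
  have h (n : ℕ) : (coordPoly F n).degree = (F.coeff n).degree := by
    rw [coordPoly, smul_eq_C_mul, degree_C_mul (Nat.cast_ne_zero.2 n.factorial_ne_zero)]
  constructor
  · intro hF
    ext1 n
    rw [coeff_dx_pow, coeff_zero]
    exact iterate_derivative_eq_zero_of_degree_lt (h n ▸ hF n)
  · intro hF n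
    rw [h, degree_lt_iff_coeff_zero]
    intro m hm
    have := dividedCoeff_dx_pow d (m - d) n F
    rw [hF, map_zero, Nat.sub_add_cancel hm, dividedCoeff_apply] at this
    exact (mul_eq_zero.1 this.symm).resolve_left (Nat.cast_ne_zero.2 (by positivity))

lemma eq_zero_of_dividedCoeff_zero_zero {F : R2} (hx : dx F = 0) (hy : dy F = 0)
    (h : dividedCoeff 0 0 F = 0) : F = 0 := by
  refine ext_dividedCoeff fun i j => ?_
  rw [map_zero]
  rcases i with _ | i
  · rcases j with _ | j
    · exact h
    · rw [← dividedCoeff_dy, hy, map_zero]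
  · rw [← dividedCoeff_dx, hx, map_zero]

/-- An operator commuting with `dx` and `dy` and vanishing on the kernel of `dx ^ e` is
`f * dx ^ e` for some `f` commuting with `dx` and `dy`. -/
lemma exists_factor_dx_pow {h : R2 →ₗ[ℂ] R2} (hx : Commute h dx) (hy : Commute h dy) {e : ℕ}
    (he : ∀ F, (dx ^ e) F = 0 → h F = 0) :
    ∃ f : R2 →ₗ[ℂ] R2, Commute f dx ∧ Commute f dy ∧ f * dx ^ e = h := by
  have hs := dx_pow_surjective e
  obtain ⟨J, hJ⟩ := (dx ^ e).exists_rightInverse_of_surjective (LinearMap.range_eq_top.2 hs)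
  have hf : h * J * dx ^ e = h := by
    refine LinearMap.ext fun F => sub_eq_zero.1 ?_
    simp only [Module.End.mul_apply]
    rw [← map_sub]
    refine he _ ?_
    rw [map_sub, sub_eq_zero]
    exact LinearMap.congr_fun hJ _
  have key {D : R2 →ₗ[ℂ] R2} (hD : Commute h D) (hD' : Commute dx D) : Commute (h * J) D := by
    refine LinearMap.ext fun F => ?_
    obtain ⟨G, rfl⟩ := hs F
    refine LinearMap.congr_fun (f := h * J * D * dx ^ e) (g := D * (h * J) * dx ^ e) ?_ G
    rw [mul_assoc _ D, ← (hD'.pow_left e).eq, ← mul_assoc, hf, hD.eq, mul_assoc D, hf]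
  exact ⟨h * J, key hx (Commute.refl _), key hy dx_comm_dy, hf⟩

section Regular

variable {f : R2 →ₗ[ℂ] R2} {s : ℕ} {P : R2}

/-- An operator of `y`-order `s` is injective on polynomials whose first `s + 1` coordinates
vanish. -/
lemma eq_zero_of_apply_eq_zero (hfx : Commute f dx) (hfy : Commute f dy)
    (hs : ∀ Q, dx Q = 0 → (dy ^ s) Q = 0 → f Q = 0)
    (hPx : dx P = 0) (hPy : (dy ^ (s + 1)) P = 0) (hP : f P ≠ 0) {F : R2} (hF : f F = 0)
    (h0 : ∀ i, ∀ n < s + 1, dividedCoeff i n F = 0) : F = 0 := by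
  classical
  by_contra hne
  have hxF := exists_dx_pow_eq_zero F
  obtain ⟨k, hk⟩ : ∃ k, Nat.find hxF = k + 1 := Nat.exists_eq_succ_of_ne_zero fun h =>
    hne (by simpa [h] using Nat.find_spec hxF)
  set G := (dx ^ k) F with hG
  have hGne : G ≠ 0 := Nat.find_min hxF (by lia)
  have hGx : dx G = 0 := by
    rw [hG, ← Module.End.mul_apply, ← pow_succ', ← hk]
    exact Nat.find_spec hxF
  have hGf : f G = 0 := by
    rw [hG, commute_apply (hfx.pow_right k), hF, map_zero]
  have hG0 (n : ℕ) (hn : n < s + 1) : dividedCoeff 0 n G = 0 := by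
    rw [hG, dividedCoeff_dx_pow, h0 _ n hn]
  have hyG := exists_dy_pow_eq_zero G
  obtain ⟨m, hm⟩ : ∃ m, Nat.find hyG = m + 1 := Nat.exists_eq_succ_of_ne_zero fun h =>
    hGne (by simpa [h] using Nat.find_spec hyG)
  have hmne : (dy ^ m) G ≠ 0 := Nat.find_min hyG (by lia)
  have hmy : dy ((dy ^ m) G) = 0 := by
    rw [← Module.End.mul_apply, ← pow_succ', ← hm]
    exact Nat.find_spec hyG
  have hmx : dx ((dy ^ m) G) = 0 := by
    rw [commute_apply (dx_comm_dy.pow_right m), hGx, map_zero]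
  have hβ : dividedCoeff 0 0 ((dy ^ m) G) ≠ 0 := fun h =>
    hmne (eq_zero_of_dividedCoeff_zero_zero hmx hmy h)
  have hsm : s < m := by
    by_contra hsm
    rw [dividedCoeff_dy_pow, hG0 _ (by lia)] at hβ
    exact hβ rfl
  set Q := (dy ^ (m - s)) G with hQ
  have hQs : (dy ^ s) Q = (dy ^ m) G := by
    rw [hQ, ← Module.End.mul_apply, ← pow_add, Nat.add_sub_cancel' hsm.le]
  have hQx : dx Q = 0 := by rw [hQ, commute_apply (dx_comm_dy.pow_right _), hGx, map_zero]
  have hQf : f Q = 0 := by rw [hQ, commute_apply (hfy.pow_right _), hGf, map_zero]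
  have hPs : dy ((dy ^ s) P) = 0 := by rw [← Module.End.mul_apply, ← pow_succ', hPy]
  have hPsx : dx ((dy ^ s) P) = 0 := by
    rw [commute_apply (dx_comm_dy.pow_right s), hPx, map_zero]
  have h := hs (dividedCoeff 0 0 ((dy ^ m) G) • P - dividedCoeff 0 0 ((dy ^ s) P) • Q)
    (by simp [hPx, hQx])
    (by
      rw [map_sub, map_smul, map_smul, hQs]
      apply eq_zero_of_dividedCoeff_zero_zero
      · simp [hPsx, hmx]
      · simp [hPs, hmy]
      · simp only [map_sub, map_smul, smul_eq_mul]
        ring)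
  rw [map_sub, map_smul, map_smul, hQf, smul_zero, sub_zero] at h
  exact (smul_ne_zero hβ hP) h

lemma exists_apply_eq_of_dx_eq_zero (hfx : Commute f dx) (hfy : Commute f dy)
    (hs : ∀ Q, dx Q = 0 → (dy ^ s) Q = 0 → f Q = 0)
    (hPx : dx P = 0) (hPy : (dy ^ (s + 1)) P = 0) (hP : f P ≠ 0) (n : ℕ) :
    ∀ G, dx G = 0 → (dy ^ n) G = 0 → ∃ F, dx F = 0 ∧ f F = G := by
  have hfPx : dx (f P) = 0 := by rw [← commute_apply hfx, hPx, map_zero]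
  have hfPy : dy (f P) = 0 := by
    rw [← commute_apply hfy]
    refine hs _ ?_ ?_
    · rw [commute_apply dx_comm_dy, hPx, map_zero]
    · rw [← Module.End.mul_apply, ← pow_succ, hPy]
  have hγ : dividedCoeff 0 0 (f P) ≠ 0 := fun h =>
    hP (eq_zero_of_dividedCoeff_zero_zero hfPx hfPy h)
  induction n with
  | zero => exact fun G _ hG => ⟨0, map_zero _, (map_zero f).trans hG.symm⟩
  | succ n ih =>
    intro G hGx hGy
    obtain ⟨P', hP'x, hP'⟩ := dy_pow_surjective_on_ker_dx n hPx
    set c := dividedCoeff 0 0 ((dy ^ n) G) / dividedCoeff 0 0 (f P) with hc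
    have hGn : dx ((dy ^ n) G) = 0 := by
      rw [commute_apply (dx_comm_dy.pow_right n), hGx, map_zero]
    obtain ⟨F, hFx, hF⟩ := ih (G - c • f P')
      (by rw [map_sub, map_smul, ← commute_apply hfx, hGx, hP'x, map_zero, smul_zero, sub_zero])
      (by
        rw [map_sub, map_smul, ← commute_apply (hfy.pow_right n), hP']
        apply eq_zero_of_dividedCoeff_zero_zero
        · rw [map_sub, map_smul, hfPx, hGn, smul_zero, sub_zero]
        · rw [map_sub, map_smul, hfPy, ← Module.End.mul_apply, ← pow_succ', hGy, smul_zero,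
            sub_zero]
        · rw [map_sub, map_smul, smul_eq_mul, hc, div_mul_cancel₀ _ hγ, sub_self])
    refine ⟨F + c • P', ?_, ?_⟩
    · rw [map_add, map_smul, hFx, hP'x, smul_zero, add_zero]
    · rw [map_add, map_smul, hF, sub_add_cancel]

lemma exists_apply_eq_of_dx_pow_eq_zero (hfx : Commute f dx) (hfy : Commute f dy)
    (hs : ∀ Q, dx Q = 0 → (dy ^ s) Q = 0 → f Q = 0)
    (hPx : dx P = 0) (hPy : (dy ^ (s + 1)) P = 0) (hP : f P ≠ 0) (e : ℕ) :
    ∀ G, (dx ^ e) G = 0 → ∃ F, (dx ^ e) F = 0 ∧ f F = G := by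
  induction e with
  | zero => exact fun G hG => ⟨0, map_zero _, (map_zero f).trans hG.symm⟩
  | succ e ih =>
    intro G hG
    obtain ⟨n, hn⟩ := exists_dy_pow_eq_zero ((dx ^ e) G)
    obtain ⟨Q, hQx, hQ⟩ := exists_apply_eq_of_dx_eq_zero hfx hfy hs hPx hPy hP n ((dx ^ e) G)
      (by rw [← Module.End.mul_apply, ← pow_succ', hG]) hn
    obtain ⟨Q', rfl⟩ := dx_pow_surjective e Q
    obtain ⟨F, hF, hFG⟩ := ih (G - f Q') (by
      rw [map_sub, ← commute_apply (hfx.pow_right e), hQ, sub_self])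
    refine ⟨F + Q', ?_, by rw [map_add, hFG, sub_add_cancel]⟩
    rw [pow_succ', Module.End.mul_apply, map_add, hF, zero_add, hQx]

end Regular

/-- Every proper submodule `A` of `ℂ[x,y]` can be written as `A = M_d + M`
with `M` an L-module of order `s` for some `d ≥ 0`, `s ≥ 1`. -/
theorem stmt4 (A : Set R2) (hA : IsSubmodule A) (hAp : A ≠ Set.univ) :
    ∃ (d s : ℕ) (M : Set R2), 1 ≤ s ∧ IsLModule s M ∧ A = Md d + M := by
  classical
  let A' : Submodule ℂ R2 :=
    { carrier := A
      zero_mem' := hA.1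
      add_mem' := fun {F G} hF hG => hA.2.1 F hF G hG
      smul_mem' := fun c F hF => hA.2.2.1 c F hF }
  have hAx : ∀ F ∈ A', dx F ∈ A' := fun F hF => dx_mem_of_polyTranslate_mem hA.2.2.2 hF
  have hAy : ∀ F ∈ A', dy F ∈ A' := fun F hF => dy_mem_of_polyTranslate_mem hA.2.2.2 hF
  have hex : ∃ e, ∃ F, (dx ^ e) F = 0 ∧ F ∉ A' := by
    obtain ⟨F, hF⟩ := (Set.ne_univ_iff_exists_notMem A).1 hAp
    obtain ⟨e, he⟩ := exists_dx_pow_eq_zero F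
    exact ⟨e, F, he, hF⟩
  obtain ⟨e, he⟩ : ∃ e, Nat.find hex = e + 1 := Nat.exists_eq_succ_of_ne_zero fun h => by
    obtain ⟨F, hF, hFA⟩ := h ▸ Nat.find_spec hex
    obtain rfl : F = 0 := hF
    exact hFA A'.zero_mem
  have hMA : ∀ F, (dx ^ e) F = 0 → F ∈ A' := fun F hF => by
    by_contra hFA
    exact Nat.find_min hex (m := e) (by lia) ⟨F, hF, hFA⟩
  obtain ⟨F, hF, hFA⟩ := he ▸ Nat.find_spec hex
  obtain ⟨φ, hφF, hφA⟩ := A'.exists_le_ker_of_notMem hFA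
  obtain ⟨h, hh⟩ := exists_operator_of_functional φ
  obtain ⟨hhx, hhy⟩ := commute_of_dividedCoeff_eq hh
  have hhA : ∀ G ∈ A', h G = 0 := fun G hG => ext_dividedCoeff fun i j => by
    rw [hh, map_zero]
    exact hφA (pow_apply_mem hAx (pow_apply_mem hAy hG j) i)
  have hhF : h F ≠ 0 := fun h0 => hφF (by simpa [h0] using (hh F 0 0).symm)
  obtain ⟨f, hfx, hfy, rfl⟩ := exists_factor_dx_pow hhx hhy fun G hG => hhA G (hMA G hG)
  have hey : ∃ n, ∃ P, dx P = 0 ∧ (dy ^ n) P = 0 ∧ f P ≠ 0 := by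
    obtain ⟨n, hn⟩ := exists_dy_pow_eq_zero ((dx ^ e) F)
    exact ⟨n, (dx ^ e) F, by rw [← Module.End.mul_apply, ← pow_succ', hF], hn, hhF⟩
  obtain ⟨s, hs⟩ : ∃ s, Nat.find hey = s + 1 := Nat.exists_eq_succ_of_ne_zero fun h0 => by
    obtain ⟨P, -, hP, hfP⟩ := h0 ▸ Nat.find_spec hey
    obtain rfl : P = 0 := hP
    exact hfP (map_zero f)
  obtain ⟨P, hPx, hPy, hP⟩ := hs ▸ Nat.find_spec hey
  have hsmin : ∀ Q, dx Q = 0 → (dy ^ s) Q = 0 → f Q = 0 := fun Q hx hy => by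
    by_contra hQ
    exact Nat.find_min hey (m := s) (by lia) ⟨Q, hx, hy, hQ⟩
  have hker {D : R2 →ₗ[ℂ] R2} (hD : Commute f D) : ∀ G ∈ LinearMap.ker f, D G ∈ LinearMap.ker f :=
    fun G hG => by
      rw [LinearMap.mem_ker, commute_apply hD, LinearMap.mem_ker.1 hG, map_zero]
  let M : Submodule ℂ R2 := A' ⊓ LinearMap.ker f
  refine ⟨e, s + 1, M, by lia, ⟨⟨M.zero_mem, fun _ hF _ hG => M.add_mem hF hG,
    fun c _ hF => M.smul_mem c hF, fun G hG a b => polyTranslate_mem (N := M)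
      (fun G hG => ⟨hAx G hG.1, hker hfx G hG.2⟩) (fun G hG => ⟨hAy G hG.1, hker hfy G hG.2⟩)
      hG a b⟩, fun G hG h0 => ?_⟩, ?_⟩
  · refine eq_zero_of_apply_eq_zero hfx hfy hsmin hPx hPy hP hG.2 fun i n hn => ?_
    have hc : G.coeff n = 0 :=
      (smul_eq_zero.1 (h0 n hn)).resolve_left (Nat.cast_ne_zero.2 n.factorial_ne_zero)
    rw [dividedCoeff_apply, hc, coeff_zero, mul_zero]
  · ext G
    rw [Set.mem_add]
    constructor
    · intro hG
      obtain ⟨Q, hQ, hfQ⟩ := exists_apply_eq_of_dx_pow_eq_zero hfx hfy hsmin hPx hPy hP e (f G) (by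
        rw [← Module.End.mul_apply, ← (hfx.pow_right e).eq, hhA G hG])
      refine ⟨Q, (mem_Md_iff_s4 e Q).2 hQ, G - Q, ⟨A'.sub_mem hG (hMA Q hQ), ?_⟩,
        add_sub_cancel Q G⟩
      rw [SetLike.mem_coe, LinearMap.mem_ker, map_sub, hfQ, sub_self]
    · rintro ⟨Q, hQ, G, hG, rfl⟩
      exact A'.add_mem (hMA Q ((mem_Md_iff_s4 e Q).1 hQ)) hG.1
end
end

section
/- Every submodule of ℂ[x_1,…,x_n] is the sum of finitely many indecomposable submodules of ℂ[x_1,…,x_n]. -/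
open scoped Pointwise BigOperators

noncomputable section

/-- The polynomial `x ↦ f(x + a)` in `ℂ[x_1,…,x_n]`. -/
noncomputable def mvTranslate {n : ℕ} (a : Fin n → ℂ) (f : MvPolynomial (Fin n) ℂ) :
    MvPolynomial (Fin n) ℂ :=
  MvPolynomial.aeval (fun i => MvPolynomial.X i + MvPolynomial.C (a i)) f

/-- A submodule of `ℂ[x_1,…,x_n]`: a translation invariant `ℂ`-linear subspace. -/
def IsSubmoduleN {n : ℕ} (M : Set (MvPolynomial (Fin n) ℂ)) : Prop :=
  (0 ∈ M) ∧ (∀ f ∈ M, ∀ g ∈ M, f + g ∈ M) ∧ (∀ (c : ℂ), ∀ f ∈ M, c • f ∈ M) ∧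
    (∀ f ∈ M, ∀ a : Fin n → ℂ, mvTranslate a f ∈ M)

/-- A submodule is decomposable if it is the sum of finitely many proper submodules of it. -/
def DecomposableN {n : ℕ} (M : Set (MvPolynomial (Fin n) ℂ)) : Prop :=
  ∃ (k : ℕ) (A : Fin k → Set (MvPolynomial (Fin n) ℂ)), 0 < k ∧
    (∀ i, IsSubmoduleN (A i) ∧ A i ⊂ M) ∧ M = ∑ i : Fin k, A i
open MvPolynomial

theorem mvTranslate_single_monomial {n : ℕ} (i : Fin n) (b : Fin n →₀ ℕ) (r : ℂ) :
    mvTranslate (Pi.single i 1) (monomial b r) =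
      ∑ k ∈ Finset.range (b i + 1),
        monomial (b.erase i + Finsupp.single i k) (r * ((b i).choose k : ℂ)) := by
  have hprod : (b.prod fun j e => (X j + C ((Pi.single i 1 : Fin n → ℂ) j) :
      MvPolynomial (Fin n) ℂ) ^ e) =
      (X i + 1) ^ b i * (b.erase i).prod fun j e => (X j : MvPolynomial (Fin n) ℂ) ^ e := by
    rw [← Finsupp.mul_prod_erase' b i _ (fun _ => pow_zero _)]
    congr 1
    · simp
    · refine Finsupp.prod_congr fun j hj => ?_
      have hji : j ≠ i := by
        rintro rfl
        simp at hj
      simp [hji]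
  rw [mvTranslate, aeval_monomial, hprod, add_pow, Finset.sum_mul, Finset.mul_sum]
  refine Finset.sum_congr rfl fun k _ => ?_
  rw [monomial_eq, Finsupp.prod_add_index' (fun _ => pow_zero _) (fun _ _ _ => pow_add _ _ _),
    Finsupp.prod_single_index (h := fun j e => (X j : MvPolynomial (Fin n) ℂ) ^ e) (pow_zero _)]
  simp only [one_pow, mul_one, MvPolynomial.algebraMap_eq, C_mul, map_natCast]
  ring

theorem mvTranslate_single_sub_monomial {n : ℕ} (i : Fin n) (b : Fin n →₀ ℕ) (r : ℂ) :
    mvTranslate (Pi.single i 1) (monomial b r) - monomial b r =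
      ∑ k ∈ Finset.range (b i),
        monomial (b.erase i + Finsupp.single i k) (r * ((b i).choose k : ℂ)) := by
  rw [mvTranslate_single_monomial, Finset.sum_range_succ, Finsupp.erase_add_single]
  simp

/-- The first difference in the direction `i` of a monomial `xᵇ` only involves monomials
dividing `xᵇ / xᵢ`. -/
theorem add_single_le_of_coeff_ne_zero {n : ℕ} {i : Fin n} {b c : Fin n →₀ ℕ} {r : ℂ}
    (h : coeff c (mvTranslate (Pi.single i 1) (monomial b r) - monomial b r) ≠ 0) :
    c + Finsupp.single i 1 ≤ b := by
  rw [mvTranslate_single_sub_monomial, coeff_sum] at h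
  obtain ⟨k, hk, hne⟩ := Finset.exists_ne_zero_of_sum_ne_zero h
  rw [coeff_monomial] at hne
  have hc : b.erase i + Finsupp.single i k = c := by
    by_contra hc
    simp [hc] at hne
  subst hc
  intro j
  have := Finset.mem_range.mp hk
  by_cases hj : j = i
  · subst hj
    simp
    omega
  · simp [hj]

theorem coeff_mvTranslate_single_sub_monomial {n : ℕ} (i : Fin n) (c : Fin n →₀ ℕ) (r : ℂ) :
    coeff c (mvTranslate (Pi.single i 1) (monomial (c + Finsupp.single i 1) r) -
      monomial (c + Finsupp.single i 1) r) = r * (c i + 1) := by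
  rw [mvTranslate_single_sub_monomial, coeff_sum, Finset.sum_eq_single (c i)]
  · have : (c + Finsupp.single i 1).erase i + Finsupp.single i (c i) = c := by
      ext j
      by_cases hj : j = i
      · subst hj
        simp
      · simp [hj]
    rw [this, coeff_monomial, if_pos rfl]
    simp
  · intro k _ hk
    rw [coeff_monomial, if_neg]
    rintro h
    apply hk
    rw [← h]
    simp
  · simp

theorem coeff_mvTranslate_single_sub {n : ℕ} (i : Fin n) (c : Fin n →₀ ℕ)
    (f : MvPolynomial (Fin n) ℂ) :
    coeff c (mvTranslate (Pi.single i 1) f - f) = ∑ b ∈ f.support,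
      coeff c (mvTranslate (Pi.single i 1) (monomial b (coeff b f)) - monomial b (coeff b f)) := by
  conv_lhs => rw [f.as_sum]
  simp only [mvTranslate, map_sum, ← Finset.sum_sub_distrib, coeff_sum]

theorem degree_mvTranslate_single_sub {n : ℕ} (m : MonomialOrder (Fin n)) (i : Fin n)
    {c : Fin n →₀ ℕ} {f : MvPolynomial (Fin n) ℂ} (hf : f ≠ 0)
    (hc : m.degree f = c + Finsupp.single i 1) :
    mvTranslate (Pi.single i 1) f - f ≠ 0 ∧
      m.degree (mvTranslate (Pi.single i 1) f - f) = c := by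
  have hcoeff : coeff c (mvTranslate (Pi.single i 1) f - f) ≠ 0 := by
    rw [coeff_mvTranslate_single_sub, Finset.sum_eq_single (c + Finsupp.single i 1),
      coeff_mvTranslate_single_sub_monomial, ← hc]
    · exact mul_ne_zero (m.coeff_degree_ne_zero_iff.mpr hf) (Nat.cast_add_one_ne_zero _)
    · intro b hb hne
      by_contra h
      refine hne (m.toSyn.injective (le_antisymm ?_
        (m.toSyn_monotone (add_single_le_of_coeff_ne_zero h))))
      rw [← hc]
      exact m.le_degree hb
    · intro h
      rw [← hc, m.degree_mem_support_iff] at h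
      exact absurd hf h
  refine ⟨fun h => hcoeff (by rw [h, coeff_zero]), m.toSyn.injective (le_antisymm ?_
    (m.le_degree (mem_support_iff.mpr hcoeff)))⟩
  rw [m.degree_le_iff]
  intro d hd
  rw [mem_support_iff, coeff_mvTranslate_single_sub] at hd
  obtain ⟨b, hb, hne⟩ := Finset.exists_ne_zero_of_sum_ne_zero hd
  have h := (m.toSyn_monotone (add_single_le_of_coeff_ne_zero hne)).trans (m.le_degree hb)
  rw [hc, map_add, map_add] at h
  exact le_of_add_le_add_right h

/-- The exponents of the leading monomials of the nonzero elements of `M`. -/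
def leadingExponents {n : ℕ} (m : MonomialOrder (Fin n)) (M : Set (MvPolynomial (Fin n) ℂ)) :
    Set (Fin n →₀ ℕ) :=
  {a | ∃ f ∈ M, f ≠ 0 ∧ m.degree f = a}

theorem IsSubmoduleN.sub_mem {n : ℕ} {M : Set (MvPolynomial (Fin n) ℂ)} (hM : IsSubmoduleN M)
    {f g : MvPolynomial (Fin n) ℂ} (hf : f ∈ M) (hg : g ∈ M) : f - g ∈ M := by
  have h := hM.2.1 f hf _ (hM.2.2.1 (-1) g hg)
  rwa [neg_one_smul, ← sub_eq_add_neg] at h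

theorem IsSubmoduleN.isLowerSet_leadingExponents {n : ℕ} (m : MonomialOrder (Fin n))
    {M : Set (MvPolynomial (Fin n) ℂ)} (hM : IsSubmoduleN M) :
    IsLowerSet (leadingExponents m M) := by
  intro a b hba ha
  obtain ⟨d, rfl⟩ := exists_add_of_le hba
  clear hba
  induction d using Finsupp.induction_linear generalizing b with
  | zero => simpa using ha
  | add d e hd he => exact hd (he (by rwa [add_assoc]))
  | single i k =>
    induction k with
    | zero => simpa using ha
    | succ k ih =>
      apply ih
      rw [Finsupp.single_add, ← add_assoc] at ha
      obtain ⟨f, hfM, hf, hfd⟩ := ha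
      obtain ⟨h0, hd⟩ := degree_mvTranslate_single_sub m i hf hfd
      exact ⟨_, hM.sub_mem (hM.2.2.2 f hfM _) hfM, h0, hd⟩

theorem IsSubmoduleN.subset_of_leadingExponents_subset {n : ℕ} (m : MonomialOrder (Fin n))
    {M N : Set (MvPolynomial (Fin n) ℂ)} (hM : IsSubmoduleN M) (hN : IsSubmoduleN N)
    (hMN : M ⊆ N) (hL : leadingExponents m N ⊆ leadingExponents m M) : N ⊆ M := by
  intro f hf
  induction hs : m.toSyn (m.degree f) using WellFoundedLT.induction generalizing f with
  | ind s ih =>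
  by_cases hf0 : f = 0
  · exact hf0 ▸ hM.1
  obtain ⟨g, hgM, hg0, hgd⟩ := hL ⟨f, hf, hf0, rfl⟩
  have hlc : coeff (m.degree f) g ≠ 0 := hgd ▸ m.coeff_degree_ne_zero_iff.mpr hg0
  set r : ℂ := coeff (m.degree f) f / coeff (m.degree f) g
  have hrg : r • g ∈ M := hM.2.2.1 r g hgM
  have hcoeff : coeff (m.degree f) (f - r • g) = 0 := by
    simp [r, hlc]
  have hrem : f - r • g ∈ M := by
    by_cases h0 : f - r • g = 0
    · exact h0 ▸ hM.1
    · refine ih _ ?_ (hN.sub_mem hf (hMN hrg)) rfl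
      rw [← hs]
      refine lt_of_le_of_ne ?_ fun h => ?_
      · refine m.degree_sub_le.trans (sup_le le_rfl ?_)
        exact m.degree_smul_le.trans (by rw [hgd])
      · refine m.coeff_degree_ne_zero_iff.mpr h0 ?_
        rw [m.toSyn.injective h, hcoeff]
  simpa using hM.2.1 _ hrem _ hrg

/-- Submodules of `ℂ[x_1,…,x_n]` satisfy the descending chain condition. -/
instance wellFoundedLT_isSubmoduleN (n : ℕ) :
    WellFoundedLT {M : Set (MvPolynomial (Fin n) ℂ) // IsSubmoduleN M} := by
  refine ⟨RelEmbedding.wellFounded_iff_isEmpty.mpr ⟨fun F => ?_⟩⟩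
  let m : MonomialOrder (Fin n) := MonomialOrder.lex
  have hanti : StrictAnti F := fun i j hij => F.map_rel_iff.mpr hij
  have hex (k : ℕ) : ∃ a ∈ leadingExponents m (F k).1, a ∉ leadingExponents m (F (k + 1)).1 := by
    have hlt : F (k + 1) < F k := hanti k.lt_succ_self
    by_contra! h
    exact hlt.not_ge ((F (k + 1)).2.subset_of_leadingExponents_subset m (F k).2 hlt.le h)
  choose a ha hna using hex
  obtain ⟨i, j, hij, hle⟩ := wellQuasiOrdered_le a
  obtain ⟨f, hf, hf0, hfd⟩ := (F j).2.isLowerSet_leadingExponents m hle (ha j)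
  exact hna i ⟨f, hanti.antitone hij hf, hf0, hfd⟩

theorem IsSubmoduleN.mem_closure_indecomposable {n : ℕ} {M : Set (MvPolynomial (Fin n) ℂ)}
    (hM : IsSubmoduleN M) :
    M ∈ AddSubmonoid.closure
      {A : Set (MvPolynomial (Fin n) ℂ) | IsSubmoduleN A ∧ ¬ DecomposableN A} := by
  suffices h : ∀ N : {M : Set (MvPolynomial (Fin n) ℂ) // IsSubmoduleN M},
      N.1 ∈ AddSubmonoid.closure
        {A : Set (MvPolynomial (Fin n) ℂ) | IsSubmoduleN A ∧ ¬ DecomposableN A} from h ⟨M, hM⟩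
  intro N
  induction N using WellFoundedLT.induction with
  | ind N ih =>
  by_cases hN : DecomposableN N.1
  · obtain ⟨k, A, -, hA, hsum⟩ := hN
    rw [hsum]
    exact sum_mem fun i _ => ih ⟨A i, (hA i).1⟩ (hA i).2
  · exact AddSubmonoid.subset_closure ⟨N.2, hN⟩

theorem isSubmoduleN_zero (n : ℕ) : IsSubmoduleN (0 : Set (MvPolynomial (Fin n) ℂ)) := by
  simp [IsSubmoduleN, mvTranslate]

theorem not_decomposableN_zero (n : ℕ) :
    ¬ DecomposableN (0 : Set (MvPolynomial (Fin n) ℂ)) := by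
  rintro ⟨k, A, hk, hA, -⟩
  obtain ⟨⟨h0, -⟩, -, hnot⟩ := hA ⟨0, hk⟩
  exact hnot (Set.zero_subset.mpr h0)

/-- Every submodule of `ℂ[x_1,…,x_n]` is the sum of finitely many indecomposable
submodules. -/
theorem stmt8 (n : ℕ) (M : Set (MvPolynomial (Fin n) ℂ)) (hM : IsSubmoduleN M) :
    ∃ (k : ℕ) (A : Fin k → Set (MvPolynomial (Fin n) ℂ)), 0 < k ∧
      (∀ i, IsSubmoduleN (A i) ∧ ¬ DecomposableN (A i)) ∧ M = ∑ i : Fin k, A i := by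
  obtain ⟨l, hl, hsum⟩ := AddSubmonoid.exists_list_of_mem_closure hM.mem_closure_indecomposable
  refine ⟨(0 :: l).length, fun i => (0 :: l)[i.1], by simp, fun i => ?_, ?_⟩
  · rcases List.mem_cons.mp (List.getElem_mem i.2 : (0 :: l)[i.1] ∈ 0 :: l) with h | h
    · simp only [h]
      exact ⟨isSubmoduleN_zero n, not_decomposableN_zero n⟩
    · exact hl _ h
  · rw [Fin.sum_univ_getElem, List.sum_cons, zero_add, hsum]
end
end

section
/- Every L-module of order 1 in ℂ[x,y] is an indecomposable submodule of ℂ[x,y]: it cannot be written as the sum of finitely many proper submodules of itself. -/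
open Polynomial
open scoped Pointwise BigOperators

noncomputable section

/-- The forward difference lowers the degree of a nonconstant polynomial by exactly one. -/
theorem coeff_taylor_one_sub (f : Polynomial ℂ) (n : ℕ) (hf : f.natDegree = n + 1) :
    (taylor 1 f - f).coeff n = (n + 1 : ℂ) * f.coeff (n + 1) := by
  have hd : (hasseDeriv n f).natDegree < 2 := by
    have := natDegree_hasseDeriv_le f n
    omega
  rw [coeff_sub, taylor_coeff, eval_eq_sum_range' hd]
  simp [Finset.sum_range_succ, hasseDeriv_coeff, add_comm 1 n]

theorem natDegree_taylor_one_sub_le (f : Polynomial ℂ) (n : ℕ) (hf : f.natDegree = n + 1) :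
    (taylor 1 f - f).natDegree ≤ n := by
  rw [natDegree_le_iff_coeff_eq_zero]
  intro m hm
  rcases eq_or_lt_of_le (Nat.succ_le_of_lt hm) with h | h
  · have h1 : m = f.natDegree := by omega
    rw [coeff_sub, h1, coeff_taylor_natDegree, coeff_natDegree, sub_self]
  · apply coeff_eq_zero_of_natDegree_lt
    have := natDegree_sub_le (taylor 1 f) f
    rw [natDegree_taylor] at this
    simp only [max_self] at this
    omega

/-- A translation invariant subspace of `ℂ[x]` containing a polynomial of degree `n` contains all
polynomials of degree at most `n`. -/
theorem mem_of_natDegree_le_of_taylor_mem (U : Submodule ℂ (Polynomial ℂ))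
    (hU : ∀ f ∈ U, taylor 1 f ∈ U) (n : ℕ) :
    ∀ f ∈ U, f ≠ 0 → f.natDegree = n → ∀ p : Polynomial ℂ, p.natDegree ≤ n → p ∈ U := by
  induction n with
  | zero =>
    intro f hf hf0 hfn p hp
    rw [eq_C_of_natDegree_eq_zero hfn] at hf hf0
    rw [eq_C_of_natDegree_le_zero hp]
    have hc : f.coeff 0 ≠ 0 := by simpa using hf0
    have := U.smul_mem (p.coeff 0 / f.coeff 0) hf
    rwa [smul_C, smul_eq_mul, div_mul_cancel₀ _ hc] at this
  | succ n ih =>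
    intro f hf hf0 hfn p hp
    have hc : f.coeff (n + 1) ≠ 0 := by
      rw [← hfn, coeff_natDegree]
      exact leadingCoeff_ne_zero.mpr hf0
    have hgc : (taylor 1 f - f).coeff n ≠ 0 := by
      rw [coeff_taylor_one_sub f n hfn]
      exact mul_ne_zero (by exact_mod_cast n.succ_ne_zero) hc
    have key := ih (taylor 1 f - f) (U.sub_mem (hU f hf) hf)
      (fun h => hgc (by rw [h, coeff_zero]))
      (le_antisymm (natDegree_taylor_one_sub_le f n hfn) (le_natDegree_of_ne_zero hgc))
      (p - (p.coeff (n + 1) / f.coeff (n + 1)) • f) (by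
        rw [natDegree_le_iff_coeff_eq_zero]
        intro m hm
        rw [coeff_sub, coeff_smul, smul_eq_mul]
        rcases eq_or_lt_of_le (Nat.succ_le_of_lt hm) with h | h
        · rw [← h, Nat.succ_eq_add_one, div_mul_cancel₀ _ hc, sub_self]
        · rw [coeff_eq_zero_of_natDegree_lt (show p.natDegree < m by omega),
            coeff_eq_zero_of_natDegree_lt (show f.natDegree < m by omega)]
          simp)
    simpa using U.add_mem key (U.smul_mem (p.coeff (n + 1) / f.coeff (n + 1)) hf)

/-- The translation invariant subspaces of `ℂ[x]` form a chain. -/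
theorem le_total_of_taylor_mem (U V : Submodule ℂ (Polynomial ℂ))
    (hU : ∀ f ∈ U, taylor 1 f ∈ U) (hV : ∀ f ∈ V, taylor 1 f ∈ V) : U ≤ V ∨ V ≤ U := by
  rw [or_iff_not_imp_left, SetLike.not_le_iff_exists]
  rintro ⟨f, hfU, hfV⟩ g hg
  have hf0 : f ≠ 0 := fun h => hfV (h ▸ V.zero_mem)
  rcases le_total g.natDegree f.natDegree with h | h
  · exact mem_of_natDegree_le_of_taylor_mem U hU _ f hfU hf0 rfl g h
  · by_cases hg0 : g = 0
    · exact hg0 ▸ U.zero_mem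
    · exact absurd (mem_of_natDegree_le_of_taylor_mem V hV _ g hg hg0 rfl f h) hfV

theorem coordPoly_zero (F : R2) : coordPoly F 0 = F.coeff 0 := by
  simp [coordPoly]

theorem coeff_zero_polyTranslate (a : ℂ) (F : R2) :
    (polyTranslate a 0 F).coeff 0 = taylor a (F.coeff 0) := by
  rw [polyTranslate, C_0, C_0, add_zero, comp_X, coeff_map, taylor_apply]
  rfl

/-- The subspace of `ℂ[x]` formed by the `0`-th coordinate polynomials of a submodule. -/
def IsSubmodule.coeffZero {A : Set R2} (hA : IsSubmodule A) : Submodule ℂ (Polynomial ℂ) where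
  carrier := (fun F : R2 => F.coeff 0) '' A
  zero_mem' := ⟨0, hA.1, coeff_zero 0⟩
  add_mem' := by
    rintro _ _ ⟨F, hF, rfl⟩ ⟨G, hG, rfl⟩
    exact ⟨F + G, hA.2.1 F hF G hG, coeff_add F G 0⟩
  smul_mem' := by
    rintro c _ ⟨F, hF, rfl⟩
    exact ⟨c • F, hA.2.2.1 c F hF, coeff_smul c F 0⟩

theorem IsSubmodule.taylor_mem_coeffZero {A : Set R2} (hA : IsSubmodule A) :
    ∀ f ∈ hA.coeffZero, taylor 1 f ∈ hA.coeffZero := by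
  rintro _ ⟨F, hF, rfl⟩
  exact ⟨polyTranslate 1 0 F, hA.2.2.2 F hF 1 0, coeff_zero_polyTranslate 1 F⟩

theorem IsLModule.injOn_coeff_zero {M : Set R2} (hM : IsLModule 1 M) :
    Set.InjOn (fun F : R2 => F.coeff 0) M := by
  intro F hF G hG h
  have hmem : F + (-1 : ℂ) • G ∈ M := hM.1.2.1 F hF _ (hM.1.2.2.1 (-1) G hG)
  have h0 : F + (-1 : ℂ) • G = 0 := by
    refine hM.2 _ hmem fun n hn => ?_
    obtain rfl : n = 0 := by omega
    rw [coordPoly_zero]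
    simpa [← sub_eq_add_neg, sub_eq_zero] using h
  simpa [← sub_eq_add_neg, sub_eq_zero] using h0

/-- The submodules of an L-module of order `1` form a chain. -/
theorem IsLModule.subset_total {M : Set R2} (hM : IsLModule 1 M) {A B : Set R2}
    (hA : IsSubmodule A) (hB : IsSubmodule B) (hAM : A ⊆ M) (hBM : B ⊆ M) : A ⊆ B ∨ B ⊆ A := by
  have hinj := hM.injOn_coeff_zero
  rcases le_total_of_taylor_mem _ _ hA.taylor_mem_coeffZero hB.taylor_mem_coeffZero with h | h
  · exact Or.inl ((hinj.image_subset_image_iff hAM hBM).mp h)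
  · exact Or.inr ((hinj.image_subset_image_iff hBM hAM).mp h)

theorem IsSubmodule.sum_mem {A : Set R2} (hA : IsSubmodule A) {ι : Type*} (s : Finset ι)
    (g : ι → R2) (hg : ∀ i ∈ s, g i ∈ A) : ∑ i ∈ s, g i ∈ A :=
  Finset.sum_induction g (· ∈ A) (fun F G hF hG => hA.2.1 F hF G hG) hA.1 hg

/-- Every L-module of order `1` is an indecomposable submodule of `ℂ[x,y]`. -/
theorem stmt12 (M : Set R2) (hM : IsLModule 1 M) : ¬ Decomposable M := by
  rintro ⟨k, A, hk, hA, hsum⟩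
  have : Nonempty (Fin k) := ⟨⟨0, hk⟩⟩
  have hdir : Directed (· ⊆ ·) A := fun i j =>
    (hM.subset_total (hA i).1 (hA j).1 (hA i).2.subset (hA j).2.subset).elim
      (fun h => ⟨j, h, subset_rfl⟩) (fun h => ⟨i, subset_rfl, h⟩)
  obtain ⟨i, hi⟩ := hdir.finite_le id
  refine (hA i).2.2 fun F hF => ?_
  rw [hsum, Set.mem_finsetSum] at hF
  obtain ⟨g, hg, rfl⟩ := hF
  exact (hA i).1.sum_mem _ g fun j hj => hi j (hg hj)
end
end

section
/- For every integer n ≥ 2 there exists a submodule M of ℂ[x_1,…,x_n] which is not closed in the topology of uniform convergence on compact sets: there is a polynomial f ∉ M and a sequence (g_k) of elements of M converging to f uniformly on every compact subset of ℂⁿ (polynomials being viewed as functions ℂⁿ → ℂ). -/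
open scoped Pointwise BigOperators

noncomputable section

section StrongRecursion

variable {α : Type*} [Inhabited α]

/-- The sequence whose `m`-th term is computed by `F m` from the earlier terms. -/
def strongSeq (F : ℕ → (ℕ → α) → α) (m : ℕ) : α :=
  F m fun i => if _h : i < m then strongSeq F i else default
termination_by m

theorem strongSeq_eq (F : ℕ → (ℕ → α) → α) (m : ℕ) :
    strongSeq F m = F m fun i => if i < m then strongSeq F i else default := by
  rw [strongSeq]
  simp

end StrongRecursion

namespace PowerSeries

/-- A first order linear differential equation has at most one formal solution with a given
constant term. -/
theorem eq_of_derivative_eq_mul {R : Type*} [CommRing R] [IsDomain R] [CharZero R]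
    {F G W : PowerSeries R} (hF : derivative R F = W * F) (hG : derivative R G = W * G)
    (h0 : coeff 0 F = coeff 0 G) : F = G := by
  ext m
  induction m using Nat.strong_induction_on with
  | _ m ih =>
    cases m with
    | zero => exact h0
    | succ m =>
      have hF' := congrArg (coeff m) hF
      have hG' := congrArg (coeff m) hG
      rw [coeff_derivative, coeff_mul] at hF' hG'
      have hm : ((m : R) + 1) ≠ 0 := by exact_mod_cast Nat.succ_ne_zero m
      apply mul_right_cancel₀ hm
      rw [hF', hG']
      refine Finset.sum_congr rfl fun p hp => ?_
      rw [ih p.2 (by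
        have := Finset.HasAntidiagonal.mem_antidiagonal.mp hp
        omega)]

theorem derivative_map {R S : Type*} [CommSemiring R] [CommSemiring S] (φ : R →+* S)
    (F : PowerSeries R) : derivative S (map φ F) = map φ (derivative R F) := by
  ext m
  simp [coeff_derivative]

end PowerSeries

open MvPolynomial in
/-- Sequences `d` and `q` such that `q` has generating function `exp (x t + y h(t))` where
`h' = ∑ dᵢ tⁱ`, and each `dₘ` is a prescribed function of the part of `(m + 1) qₘ₊₁` which
does not involve it. -/
theorem exists_exponential_sequence {σ : Type*} (i j : σ) (B : ℕ → MvPolynomial σ ℂ → ℂ) :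
    ∃ (d : ℕ → ℂ) (q S : ℕ → MvPolynomial σ ℂ), q 0 = 1 ∧
      (∀ m : ℕ, ((m : MvPolynomial σ ℂ) + 1) * q (m + 1) = S m + C (d m) * X j) ∧
      (∀ m, d m = B m (S m)) ∧
      PowerSeries.derivative _ (PowerSeries.mk q) =
        (PowerSeries.C (X i) + PowerSeries.C (X j) * PowerSeries.mk fun m => C (d m)) *
          PowerSeries.mk q := by
  let next : ℕ → (ℕ → MvPolynomial σ ℂ × MvPolynomial σ ℂ) → MvPolynomial σ ℂ := fun m p =>
    if m = 0 then 1 else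
      C ((m : ℂ)⁻¹) * ((p (m - 1)).2 + C (B (m - 1) (p (m - 1)).2) * X j)
  let F : ℕ → (ℕ → MvPolynomial σ ℂ × MvPolynomial σ ℂ) →
      MvPolynomial σ ℂ × MvPolynomial σ ℂ := fun m p =>
    (next m p, X i * next m p + X j * ∑ k ∈ Finset.range m,
      C (B k (p k).2) * if k = 0 then next m p else (p (m - k)).1)
  let s := strongSeq F
  have hq0 : (s 0).1 = 1 := by
    simp only [s]
    rw [strongSeq_eq]
    simp [F, next]
  have hq : ∀ m : ℕ, ((m : MvPolynomial σ ℂ) + 1) * (s (m + 1)).1 =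
      (s m).2 + C (B m (s m).2) * X j := by
    intro m
    have h : (s (m + 1)).1 = C (((m + 1 : ℕ) : ℂ)⁻¹) * ((s m).2 + C (B m (s m).2) * X j) := by
      simp only [s]
      rw [strongSeq_eq]
      simp [F, next]
    have hm : ((m : ℂ) + 1) ≠ 0 := by exact_mod_cast Nat.succ_ne_zero m
    have hc : ((m : MvPolynomial σ ℂ) + 1) = C ((m : ℂ) + 1) := by simp
    rw [h, hc, ← mul_assoc, ← C_mul]
    push_cast
    rw [mul_inv_cancel₀ hm, C_1, one_mul]
  have hS : ∀ m, (s m).2 = X i * (s m).1 + X j * ∑ k ∈ Finset.range m,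
      C (B k (s k).2) * (s (m - k)).1 := by
    intro m
    have e : s m = F m fun k => if k < m then s k else default := strongSeq_eq F m
    have e1 : (s m).1 = next m fun k => if k < m then s k else default := by rw [e]
    conv_lhs => rw [e]
    simp only [F]
    rw [← e1]
    congr 2
    refine Finset.sum_congr rfl fun k hk => ?_
    have hk' := Finset.mem_range.mp hk
    rw [if_pos hk']
    split_ifs with h0 h1
    · simp [h0]
    · rfl
    · omega
  refine ⟨fun m => B m (s m).2, fun m => (s m).1, fun m => (s m).2, hq0, hq, fun _ => rfl, ?_⟩
  ext1 m
  rw [PowerSeries.coeff_derivative, PowerSeries.coeff_mk, mul_comm, hq, add_mul, map_add,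
    mul_assoc, PowerSeries.coeff_C_mul, PowerSeries.coeff_C_mul, PowerSeries.coeff_mk,
    PowerSeries.coeff_mul, Finset.Nat.sum_antidiagonal_eq_sum_range_succ_mk,
    Finset.sum_range_succ]
  simp only [PowerSeries.coeff_mk, Nat.sub_self, hq0]
  linear_combination hS m

open MvPolynomial in
theorem mvTranslate_exponential {n : ℕ} {i j : Fin n} {d : ℕ → ℂ}
    {q : ℕ → MvPolynomial (Fin n) ℂ} (hq0 : q 0 = 1)
    (hq : PowerSeries.derivative _ (PowerSeries.mk q) =
      (PowerSeries.C (X i) + PowerSeries.C (X j) * PowerSeries.mk fun m => C (d m)) *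
        PowerSeries.mk q) (a : Fin n → ℂ) (m : ℕ) :
    mvTranslate a (q m) = ∑ p ∈ Finset.HasAntidiagonal.antidiagonal m, eval a (q p.2) • q p.1 := by
  let τ : MvPolynomial (Fin n) ℂ →+* MvPolynomial (Fin n) ℂ :=
    (aeval fun k => X k + C (a k) : MvPolynomial (Fin n) ℂ →ₐ[ℂ] _).toRingHom
  let ε : MvPolynomial (Fin n) ℂ →+* MvPolynomial (Fin n) ℂ := C.comp (eval a)
  have hτX : ∀ k, τ (X k) = X k + C (a k) := fun k => by simp [τ]
  have hτC : ∀ c, τ (C c) = C c := fun c => by simp [τ, algebraMap_eq]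
  have hεX : ∀ k, ε (X k) = C (a k) := fun k => by simp [ε]
  have hεC : ∀ c, ε (C c) = C c := fun c => by simp [ε]
  have hmap : ∀ φ : MvPolynomial (Fin n) ℂ →+* MvPolynomial (Fin n) ℂ, (∀ c, φ (C c) = C c) →
      PowerSeries.map φ (PowerSeries.mk fun m => C (d m)) =
        PowerSeries.mk fun m => C (d m) := fun φ hφ => by
    ext1 k
    simp [hφ]
  have key : PowerSeries.map τ (PowerSeries.mk q) =
      PowerSeries.mk q * PowerSeries.map ε (PowerSeries.mk q) := by
    apply PowerSeries.eq_of_derivative_eq_mul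
      (W := PowerSeries.C (X i + C (a i)) +
        PowerSeries.C (X j + C (a j)) * PowerSeries.mk fun m => C (d m))
    · rw [PowerSeries.derivative_map, hq, map_mul, map_add, map_mul, PowerSeries.map_C,
        PowerSeries.map_C, hmap τ hτC, hτX, hτX]
    · rw [Derivation.leibniz, PowerSeries.derivative_map, hq, map_mul, map_add, map_mul,
        PowerSeries.map_C, PowerSeries.map_C, hmap ε hεC, hεX, hεX]
      simp only [smul_eq_mul, map_add]
      ring
    · simp only [PowerSeries.coeff_map, PowerSeries.coeff_mk, PowerSeries.coeff_mul,
        Finset.Nat.antidiagonal_zero, Finset.sum_singleton, hq0, map_one, mul_one]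
  have h := congrArg (PowerSeries.coeff m) key
  rw [PowerSeries.coeff_map, PowerSeries.coeff_mk, PowerSeries.coeff_mul] at h
  refine h.trans (Finset.sum_congr rfl fun p _ => ?_)
  simp [ε, smul_eq_C_mul, mul_comm]

open MvPolynomial in
theorem X_notMem_span_exponential {σ : Type*} {i j : σ} (hij : i ≠ j)
    {d : ℕ → ℂ} {q : ℕ → MvPolynomial σ ℂ} (hq0 : q 0 = 1)
    (hq : PowerSeries.derivative _ (PowerSeries.mk q) =
      (PowerSeries.C (X i) + PowerSeries.C (X j) * PowerSeries.mk fun m => C (d m)) *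
        PowerSeries.mk q) :
    (X j : MvPolynomial σ ℂ) ∉ Submodule.span ℂ (Set.range q) := by
  classical
  let φ : MvPolynomial σ ℂ →ₐ[ℂ] Polynomial ℂ := aeval (Pi.single i Polynomial.X)
  have hφi : φ (X i) = Polynomial.X := by simp [φ]
  have hφj : φ (X j) = 0 := by simp [φ, hij.symm]
  have hstep : ∀ m : ℕ, φ (q (m + 1)) * ((m : Polynomial ℂ) + 1) = Polynomial.X * φ (q m) := by
    intro m
    have h := congrArg (fun F => φ (PowerSeries.coeff m F)) hq
    rw [add_mul, mul_assoc] at h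
    simpa only [PowerSeries.coeff_derivative, map_add, map_mul, PowerSeries.coeff_C_mul,
      PowerSeries.coeff_mk, hφi, hφj, zero_mul, add_zero, map_natCast, map_one] using h
  have hφq : ∀ m : ℕ, φ (q m) = Polynomial.monomial m ((m.factorial : ℂ)⁻¹) := by
    intro m
    induction m with
    | zero => simp [hq0]
    | succ m ih =>
      have hm : ((m : ℂ) + 1) ≠ 0 := by exact_mod_cast Nat.succ_ne_zero m
      have hm' : ((m : Polynomial ℂ) + 1) ≠ 0 := by exact_mod_cast Nat.succ_ne_zero m
      apply mul_right_cancel₀ hm'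
      have hc : ((m : Polynomial ℂ) + 1) = Polynomial.C ((m : ℂ) + 1) := by simp
      rw [hstep, ih, hc, Polynomial.X_mul_monomial, Polynomial.monomial_mul_C,
        Nat.factorial_succ]
      push_cast
      rw [mul_inv, mul_comm, ← mul_assoc, mul_inv_cancel₀ hm, one_mul]
  intro hmem
  obtain ⟨c, hc⟩ := Finsupp.mem_span_range_iff_exists_finsupp.mp hmem
  have h0 : c = 0 := by
    ext m
    have h := congrArg (fun p => (φ p).coeff m) hc
    simp only [Finsupp.sum, map_sum, map_smul, hφq, hφj, Polynomial.finsetSum_coeff,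
      Polynomial.coeff_smul, Polynomial.coeff_monomial, smul_eq_mul, mul_ite, mul_zero,
      Finset.sum_ite_eq', Polynomial.coeff_zero, Finsupp.mem_support_iff] at h
    by_contra hne
    rw [Finsupp.zero_apply] at hne
    rw [if_pos hne] at h
    exact mul_ne_zero hne (inv_ne_zero (by exact_mod_cast m.factorial_ne_zero)) h
  rw [h0, Finsupp.sum_zero_index] at hc
  exact X_ne_zero j hc.symm

/-- A scalar dominating a polynomial on a ball, with a given margin. -/
theorem exists_ne_zero_dominating {n : ℕ} (m : ℕ) (P : MvPolynomial (Fin n) ℂ) :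
    ∃ b : ℂ, b ≠ 0 ∧ ∀ x : Fin n → ℂ, ‖x‖ ≤ m →
      ‖b⁻¹ * MvPolynomial.eval x P‖ ≤ ((m : ℝ) + 1)⁻¹ := by
  obtain ⟨R, hR⟩ := (isCompact_closedBall (0 : Fin n → ℂ) (m : ℝ)).exists_bound_of_continuousOn
    (MvPolynomial.continuous_eval P).continuousOn
  have hb : (0 : ℝ) < ((m : ℝ) + 1) * (|R| + 1) := by positivity
  refine ⟨(((m : ℝ) + 1) * (|R| + 1) : ℝ), by exact_mod_cast hb.ne', fun x hx => ?_⟩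
  have h := hR x (by simpa using hx)
  rw [norm_mul, norm_inv, Complex.norm_real, Real.norm_of_nonneg hb.le, mul_inv, mul_assoc]
  refine mul_le_of_le_one_right (by positivity) ?_
  rw [inv_mul_le_iff₀ (by positivity), mul_one]
  linarith [le_abs_self R]

/-- For every `n ≥ 2` there is a submodule of `ℂ[x_1,…,x_n]` which is not closed in the
topology of uniform convergence on compact sets. -/
theorem stmt14 (n : ℕ) (hn : 2 ≤ n) :
    ∃ M : Set (MvPolynomial (Fin n) ℂ), IsSubmoduleN M ∧
      ∃ f : MvPolynomial (Fin n) ℂ, f ∉ M ∧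
        ∃ g : ℕ → MvPolynomial (Fin n) ℂ, (∀ k, g k ∈ M) ∧
          ∀ K : Set (Fin n → ℂ), IsCompact K →
            TendstoUniformlyOn (fun k x => MvPolynomial.eval x (g k))
              (fun x => MvPolynomial.eval x f) Filter.atTop K := by
  choose B hB0 hB using exists_ne_zero_dominating (n := n)
  let i : Fin n := ⟨0, by omega⟩
  let j : Fin n := ⟨1, by omega⟩
  have hij : i ≠ j := by simp [i, j]
  obtain ⟨d, q, S, hq0, hqS, hd, hq⟩ := exists_exponential_sequence i j B
  have hd0 : ∀ m, d m ≠ 0 := fun m => hd m ▸ hB0 m _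
  let M : Submodule ℂ (MvPolynomial (Fin n) ℂ) := Submodule.span ℂ (Set.range q)
  have hqM : ∀ m, q m ∈ M := fun m => Submodule.subset_span ⟨m, rfl⟩
  refine ⟨M, ⟨M.zero_mem, fun f hf g hg => M.add_mem hf hg, fun c f hf => M.smul_mem c hf,
    fun f hf a => ?_⟩, MvPolynomial.X j, X_notMem_span_exponential hij hq0 hq,
    fun m => ((d m)⁻¹ * ((m : ℂ) + 1)) • q (m + 1), fun m => M.smul_mem _ (hqM _), fun K hK => ?_⟩
  · let τ := (MvPolynomial.aeval fun k => MvPolynomial.X k + MvPolynomial.C (a k) :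
      MvPolynomial (Fin n) ℂ →ₐ[ℂ] MvPolynomial (Fin n) ℂ).toLinearMap
    have hle : M ≤ M.comap τ := by
      refine Submodule.span_le.mpr ?_
      rintro _ ⟨m, rfl⟩
      change mvTranslate a (q m) ∈ M
      rw [mvTranslate_exponential hq0 hq]
      exact M.sum_mem fun p _ => M.smul_mem _ (hqM _)
    exact hle hf
  · have heval : ∀ m x, MvPolynomial.eval x (((d m)⁻¹ * ((m : ℂ) + 1)) • q (m + 1)) =
        x j + (d m)⁻¹ * MvPolynomial.eval x (S m) := by
      intro m x
      have h := congrArg (MvPolynomial.eval x) (hqS m)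
      simp only [map_mul, map_add, map_natCast, map_one, MvPolynomial.eval_C,
        MvPolynomial.eval_X] at h
      rw [MvPolynomial.smul_eval, mul_assoc, h, mul_add, inv_mul_cancel_left₀ (hd0 m), add_comm]
    obtain ⟨r, hr⟩ := hK.isBounded.exists_norm_le
    rw [Metric.tendstoUniformlyOn_iff]
    intro e he
    have hlim := tendsto_one_div_add_atTop_nhds_zero_nat (𝕜 := ℝ)
    filter_upwards [hlim.eventually (gt_mem_nhds he), Filter.eventually_ge_atTop ⌈r⌉₊]
      with m hm hrm x hx
    rw [heval, MvPolynomial.eval_X, dist_self_add_right, hd]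
    refine (hB m (S m) x ((hr x hx).trans (Nat.ceil_le.mp hrm))).trans_lt ?_
    simpa using hm
end
end
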